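/- arXiv:2305.03285 — 4 statements merged into one kernel-verified Lean document; each statement's English description precedes it below -/
import Mathlib

section
/- Let C be the extended quaternary quadratic residue code of length 18 and let B = {supp(c) : c ∈ C, wt(c) = 10} be the set of distinct supports of weight-10 codewords. Then B is a simple combinatorial 3-(18, 10, 315) design: every 3-element subset of {1,…,18} is contained in exactly 315 members of B. Moreover B is not a 4-design: there exist 4-element subsets T and T′ of {1,…,18} contained in different numbers of members of B. -/
open scoped Classical

noncomputable section

/-- The field with four elements. -/
abbrev F4 := GaloisField 2 2

/-- Membership in the quaternary quadratic residue code of length 17: the codeword, viewed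
as the polynomial `∑ cᵢ Xⁱ` modulo `X ^ 17 - 1`, lies in the ideal generated by the
polynomial whose roots are `α ^ ℓ` for `ℓ` running over the nonzero squares mod 17;
equivalently (as that generator is separable and divides `X ^ 17 - 1`), the codeword
polynomial vanishes at `α ^ ℓ` for every nonzero square `ℓ` modulo 17. -/
def qr4Mem {K : Type} [Field K] [Algebra F4 K] (α : K) (c : Fin 17 → F4) : Prop :=
  ∀ ℓ : ZMod 17, ℓ ≠ 0 → IsSquare ℓ →
    ∑ i : Fin 17, algebraMap F4 K (c i) * α ^ (ℓ.val * (i : ℕ)) = 0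

/-- Membership in the extended quaternary quadratic residue code of length 18: the first 17
coordinates form a codeword of the quadratic residue code of length 17 and the last
coordinate is minus the sum of the first 17. -/
def extQR4Mem {K : Type} [Field K] [Algebra F4 K] (α : K) (c : Fin 18 → F4) : Prop :=
  qr4Mem α (fun i => c i.castSucc) ∧ c (Fin.last 17) = - ∑ i : Fin 17, c i.castSucc

/-- Hamming weight: the number of nonzero coordinates. -/
def wt {n : ℕ} {F : Type} [Zero F] (c : Fin n → F) : ℕ :=
  (Finset.univ.filter fun i => c i ≠ 0).card

/-- Support: the set of nonzero coordinate positions. -/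
def supp {n : ℕ} {F : Type} [Zero F] (c : Fin n → F) : Finset (Fin n) :=
  Finset.univ.filter fun i => c i ≠ 0

/-! ### Binary words as bit masks -/

/-- All sums (bitwise exclusive or) of sublists of a list of bit masks. -/
def xorSpan : List ℕ → List ℕ
  | [] => [0]
  | g :: gs => xorSpan gs ++ (xorSpan gs).map (Nat.xor g)

/-- The `j`-th bit of `x`, as an element of `R`. -/
def bit (R : Type) [Zero R] [One R] (x j : ℕ) : R := if x.testBit j then 1 else 0

lemma bit_xor (x y j : ℕ) : bit (ZMod 2) (x ^^^ y) j = bit (ZMod 2) x j + bit (ZMod 2) y j := by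
  unfold bit
  rw [Nat.testBit_xor]
  cases x.testBit j <;> cases y.testBit j <;> decide

lemma map_bit {R S : Type} [NonAssocSemiring R] [NonAssocSemiring S] (f : R →+* S) (x j : ℕ) :
    f (bit R x j) = bit S x j := by
  unfold bit
  split_ifs <;> simp

lemma bit_ne_zero_iff (x j : ℕ) : bit (ZMod 2) x j ≠ 0 ↔ x.testBit j = true := by
  unfold bit
  split_ifs with h <;> simp [h]

lemma exists_coeff_of_mem_xorSpan (gs : List ℕ) : ∀ x ∈ xorSpan gs,
    ∃ a : Fin gs.length → ZMod 2, ∀ j,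
      bit (ZMod 2) x j = ∑ i, a i * bit (ZMod 2) (gs.get i) j := by
  induction gs with
  | nil =>
    intro x hx
    obtain rfl : x = 0 := by simpa [xorSpan] using hx
    exact ⟨0, fun j => by simp [bit]⟩
  | cons g gs ih =>
    intro x hx
    rw [xorSpan, List.mem_append, List.mem_map] at hx
    rcases hx with hx | ⟨y, hy, rfl⟩
    · obtain ⟨a, ha⟩ := ih x hx
      exact ⟨Fin.cons 0 a, fun j => by simp [Fin.sum_univ_succ, ha]⟩
    · obtain ⟨a, ha⟩ := ih y hy
      refine ⟨Fin.cons 1 a, fun j => ?_⟩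
      change bit (ZMod 2) (g ^^^ y) j = _
      simp [Fin.sum_univ_succ, bit_xor, ha]

lemma exists_mem_xorSpan_of_coeff (gs : List ℕ) : ∀ a : Fin gs.length → ZMod 2,
    ∃ x ∈ xorSpan gs, ∀ j, bit (ZMod 2) x j = ∑ i, a i * bit (ZMod 2) (gs.get i) j := by
  induction gs with
  | nil => exact fun a => ⟨0, by simp [xorSpan], fun j => by simp [bit]⟩
  | cons g gs ih =>
    intro a
    obtain ⟨x, hx, hxa⟩ := ih (fun i => a i.succ)
    obtain h | h : a 0 = 0 ∨ a 0 = 1 := by generalize a 0 = t; revert t; decide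
    · refine ⟨x, by simp [xorSpan, hx], fun j => ?_⟩
      have := hxa j
      simp_all [Fin.sum_univ_succ]
    · refine ⟨g ^^^ x, ?_, fun j => ?_⟩
      · rw [xorSpan, List.mem_append, List.mem_map]
        exact Or.inr ⟨x, hx, rfl⟩
      · have := hxa j
        simp_all [Fin.sum_univ_succ, bit_xor]

lemma lt_two_pow_of_mem_xorSpan {n : ℕ} (gs : List ℕ) (h : ∀ g ∈ gs, g < 2 ^ n) :
    ∀ x ∈ xorSpan gs, x < 2 ^ n := by
  induction gs with
  | nil => simp [xorSpan]
  | cons g gs ih =>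
    intro x hx
    rw [xorSpan, List.mem_append, List.mem_map] at hx
    have ih' := ih fun g' hg' => h g' (List.mem_cons_of_mem _ hg')
    rcases hx with hx | ⟨y, hy, rfl⟩
    · exact ih' x hx
    · exact Nat.xor_lt_two_pow (h g List.mem_cons_self) (ih' y hy)

lemma xor_mem_xorSpan (gs : List ℕ) : ∀ x ∈ xorSpan gs, ∀ y ∈ xorSpan gs,
    x ^^^ y ∈ xorSpan gs := by
  induction gs with
  | nil => simp [xorSpan]
  | cons g gs ih =>
    intro x hx y hy
    rw [xorSpan, List.mem_append, List.mem_map] at hx hy ⊢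
    rcases hx with hx | ⟨x, hx, rfl⟩ <;> rcases hy with hy | ⟨y, hy, rfl⟩
    · exact Or.inl (ih x hx y hy)
    · exact Or.inr ⟨x ^^^ y, ih x hx y hy, Nat.xor_left_comm g x y⟩
    · exact Or.inr ⟨x ^^^ y, ih x hx y hy, (Nat.xor_assoc g x y).symm⟩
    · refine Or.inl ?_
      have : g.xor x ^^^ g.xor y = x ^^^ y := by
        change (g ^^^ x) ^^^ (g ^^^ y) = x ^^^ y
        apply Nat.eq_of_testBit_eq
        intro i
        simp only [Nat.testBit_xor]
        cases g.testBit i <;> simp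
      rw [this]
      exact ih x hx y hy

/-- The set of positions below `18` at which the bit mask `x` is nonzero. -/
def maskSet (x : ℕ) : Finset (Fin 18) := Finset.univ.filter fun i => x.testBit i = true

@[simp] lemma mem_maskSet (x : ℕ) (i : Fin 18) : i ∈ maskSet x ↔ x.testBit i = true := by
  simp [maskSet]

lemma maskSet_injOn : Set.InjOn maskSet {x | x < 2 ^ 18} := by
  intro x hx y hy h
  apply Nat.eq_of_testBit_eq
  intro i
  by_cases hi : i < 18
  · have := Finset.ext_iff.1 h ⟨i, hi⟩
    rw [mem_maskSet, mem_maskSet] at this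
    exact Bool.eq_iff_iff.2 this
  · have hle : 2 ^ 18 ≤ 2 ^ i := Nat.pow_le_pow_right (by norm_num) (by omega)
    rw [Nat.testBit_eq_false_of_lt (lt_of_lt_of_le hx hle),
      Nat.testBit_eq_false_of_lt (lt_of_lt_of_le hy hle)]

/-- A table, with entries of three bits, of the bit counts of the numbers below `64`. -/
def popTable : ℕ :=
  (List.range 64).foldr (fun v t => 8 * t + (List.range 6).countP (v.testBit ·)) 0

/-- The number of nonzero bits among the lowest six bits of `v`. -/
def popCountSix (v : ℕ) : ℕ := Nat.mod (Nat.shiftRight popTable (Nat.mul 3 (Nat.mod v 64))) 8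

/-- The number of nonzero bits among the lowest eighteen bits of `v`. -/
def popCount (v : ℕ) : ℕ :=
  Nat.add (popCountSix v) (Nat.add (popCountSix (Nat.div v 64)) (popCountSix (Nat.div v 4096)))

lemma popCountSix_eq (v : ℕ) : popCountSix v = ∑ i : Fin 6, (v.testBit i).toNat := by
  have key : ∀ w < 64, popCountSix w = ∑ i : Fin 6, (w.testBit i).toNat := by decide +kernel
  have hmod : popCountSix v = popCountSix (v % 64) := by
    change Nat.mod (Nat.shiftRight _ (Nat.mul 3 (v % 64))) 8 =
      Nat.mod (Nat.shiftRight _ (Nat.mul 3 (v % 64 % 64))) 8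
    rw [Nat.mod_mod]
  rw [hmod, key _ (Nat.mod_lt _ (by norm_num))]
  refine Finset.sum_congr rfl fun i _ => ?_
  rw [show 64 = 2 ^ 6 by norm_num, Nat.testBit_mod_two_pow]
  simp

lemma card_maskSet (x : ℕ) : (maskSet x).card = popCount x := by
  have h : (maskSet x).card = ∑ i : Fin 18, (x.testBit i).toNat := by
    rw [maskSet, Finset.card_filter]
    refine Finset.sum_congr rfl fun i _ => ?_
    cases x.testBit i <;> simp
  change _ = popCountSix x + (popCountSix (x / 2 ^ 6) + popCountSix (x / 2 ^ 12))
  rw [h]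
  simp only [popCountSix_eq, Nat.testBit_div_two_pow]
  rw [Fin.sum_univ_eq_sum_range (fun i => (x.testBit i).toNat) 18,
    Fin.sum_univ_eq_sum_range (fun i => (x.testBit i).toNat) 6,
    Fin.sum_univ_eq_sum_range (fun i => (x.testBit (i + 6)).toNat) 6,
    Fin.sum_univ_eq_sum_range (fun i => (x.testBit (i + 12)).toNat) 6]
  simp only [Finset.sum_range_succ, Finset.sum_range_zero, zero_add, Nat.reduceAdd]
  ring

/-- Checks that the entries of a list are pairwise distinct, recording the entries met so far
as the nonzero bits of `m`. -/
def distinctFrom : List ℕ → ℕ → Bool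
  | [], _ => true
  | x :: xs, m => !m.testBit x && distinctFrom xs (m ||| 1 <<< x)

lemma nodup_of_distinctFrom (l : List ℕ) : ∀ m, distinctFrom l m = true →
    l.Nodup ∧ ∀ x ∈ l, m.testBit x = false := by
  induction l with
  | nil => simp
  | cons x l ih =>
    intro m h
    rw [distinctFrom, Bool.and_eq_true, Bool.not_eq_true'] at h
    obtain ⟨hnd, hm⟩ := ih _ h.2
    have hm' : ∀ y ∈ l, m.testBit y = false ∧ x ≠ y := by
      intro y hy
      have := hm y hy
      rw [Nat.testBit_or, Bool.or_eq_false_iff] at this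
      refine ⟨this.1, ?_⟩
      rintro rfl
      simpa using this.2
    refine ⟨List.nodup_cons.2 ⟨fun hx => (hm' x hx).2 rfl, hnd⟩, ?_⟩
    intro y hy
    rcases List.mem_cons.1 hy with rfl | hy
    · exact h.1
    · exact (hm' y hy).1

/-- The number of entries of a list of bit masks whose bits include those of `m`. -/
def countAbove (m : ℕ) (l : List ℕ) : ℕ :=
  List.rec 0 (fun x _ n => bif Nat.beq (Nat.land x m) m then n + 1 else n) l

lemma countAbove_eq (m : ℕ) (l : List ℕ) :
    countAbove m l = (l.filter fun x => x &&& m == m).length := by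
  induction l with
  | nil => rfl
  | cons x l ih =>
    have h : countAbove m (x :: l) =
        bif Nat.beq (x &&& m) m then countAbove m l + 1 else countAbove m l := rfl
    by_cases hx : x &&& m = m
    · rw [h, hx, Nat.beq_refl]
      simp [hx, ih]
    · rw [h, Bool.eq_false_iff.2 (mt Nat.eq_of_beq_eq_true hx)]
      simp [hx, ih]

lemma land_eq_iff_maskSet_subset {x m : ℕ} (hm : m < 2 ^ 18) :
    x &&& m = m ↔ maskSet m ⊆ maskSet x := by
  constructor
  · intro h i hi
    rw [mem_maskSet] at hi ⊢
    rw [← h, Nat.testBit_and, Bool.and_eq_true] at hi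
    exact hi.1
  · intro h
    apply Nat.eq_of_testBit_eq
    intro i
    rw [Nat.testBit_and]
    by_cases hi : i < 18
    · have := @h ⟨i, hi⟩
      simp only [mem_maskSet] at this
      cases hmi : m.testBit i
      · simp
      · simp [this hmi]
    · have hle : 2 ^ 18 ≤ 2 ^ i := Nat.pow_le_pow_right (by norm_num) (by omega)
      simp [Nat.testBit_eq_false_of_lt (lt_of_lt_of_le hm hle)]

/-- The rows of a systematic generator matrix, with information positions `8, …, 16`, of the
extended binary quadratic residue code of length 18. -/
def rows : List ℕ := [131385, 131698, 132324, 2289, 135387, 8335, 147495, 163918, 196764]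

/-- The codewords of weight at most ten whose first coordinate is `b`. -/
def lightWords (b : ℕ) : List ℕ :=
  (xorSpan rows).filter fun x => Nat.beq (Nat.mod x 2) b && Nat.ble (popCount x) 10

/-- The ten-element sets containing the position `0` that are unions of the supports of two
binary codewords. -/
def unionMasks : List ℕ :=
  (lightWords 1).flatMap fun a => ((lightWords 0).filter fun b =>
    Nat.beq (popCount (Nat.lor a b)) 10 && Nat.ble a (Nat.xor a b)).map (Nat.lor a)

lemma nodup_unionMasks : unionMasks.Nodup :=
  (nodup_of_distinctFrom unionMasks 0 (by decide +kernel)).1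

lemma countAbove_three : ∀ y z : Fin 18, 0 < y → y < z →
    countAbove (1 + 2 ^ y.val + 2 ^ z.val) unionMasks = 315 := by decide +kernel

lemma countAbove_four : countAbove 15 unionMasks = 147 ∧ countAbove 23 unionMasks = 146 := by
  decide +kernel

lemma xorSpan_rows_lt : ∀ x ∈ xorSpan rows, x < 2 ^ 18 :=
  lt_two_pow_of_mem_xorSpan rows (by decide +kernel)

lemma popCount_le_popCount_lor (x y : ℕ) : popCount x ≤ popCount (x ||| y) := by
  rw [← card_maskSet, ← card_maskSet]
  refine Finset.card_le_card fun i hi => ?_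
  rw [mem_maskSet] at hi ⊢
  simp [hi]

lemma mem_lightWords {b x : ℕ} :
    x ∈ lightWords b ↔ x ∈ xorSpan rows ∧ x % 2 = b ∧ popCount x ≤ 10 := by
  rw [lightWords, List.mem_filter, Bool.and_eq_true, Nat.beq_eq, Nat.ble_eq]
  rfl

lemma mem_unionMasks {s : ℕ} : s ∈ unionMasks ↔
    ∃ x ∈ xorSpan rows, ∃ y ∈ xorSpan rows, x % 2 = 1 ∧ y % 2 = 0 ∧
      popCount (x ||| y) = 10 ∧ x ≤ x ^^^ y ∧ x ||| y = s := by
  have key : s ∈ unionMasks ↔ ∃ x ∈ lightWords 1, ∃ y ∈ lightWords 0,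
      popCount (x ||| y) = 10 ∧ x ≤ x ^^^ y ∧ x ||| y = s := by
    simp only [unionMasks, List.mem_flatMap, List.mem_map, List.mem_filter, Bool.and_eq_true,
      Nat.beq_eq, Nat.ble_eq, and_assoc]
    rfl
  rw [key]
  constructor
  · rintro ⟨x, hx, y, hy, h⟩
    rw [mem_lightWords] at hx hy
    exact ⟨x, hx.1, y, hy.1, hx.2.1, hy.2.1, h⟩
  · rintro ⟨x, hx, y, hy, hx1, hy0, hc, h⟩
    refine ⟨x, mem_lightWords.2 ⟨hx, hx1, ?_⟩, y, mem_lightWords.2 ⟨hy, hy0, ?_⟩, hc, h⟩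
    · exact hc ▸ popCount_le_popCount_lor x y
    · rw [Nat.lor_comm] at hc
      exact hc ▸ popCount_le_popCount_lor y x

/-- A family of sets is the family of all ten-element unions of the supports of two binary
codewords. -/
def IsUnionFamily (B : Set (Finset (Fin 18))) : Prop :=
  ∀ S, S ∈ B ↔ ∃ x ∈ xorSpan rows, ∃ y ∈ xorSpan rows,
    popCount (x ||| y) = 10 ∧ S = maskSet (x ||| y)

lemma lor_lt_of_mem {x y : ℕ} (hx : x ∈ xorSpan rows) (hy : y ∈ xorSpan rows) :
    x ||| y < 2 ^ 18 :=
  Nat.or_lt_two_pow (xorSpan_rows_lt x hx) (xorSpan_rows_lt y hy)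

lemma IsUnionFamily.mem_iff_of_zero_mem {B : Set (Finset (Fin 18))} (hB : IsUnionFamily B)
    {S : Finset (Fin 18)} (h0 : 0 ∈ S) : S ∈ B ↔ ∃ s ∈ unionMasks, maskSet s = S := by
  have xor_xor (x y : ℕ) : (x ^^^ y) ^^^ y = x := by
    rw [Nat.xor_assoc, Nat.xor_self, Nat.xor_zero]
  have lor_xor (x y : ℕ) : (x ^^^ y) ||| y = x ||| y := by
    apply Nat.eq_of_testBit_eq
    intro i
    simp only [Nat.testBit_or, Nat.testBit_xor]
    cases x.testBit i <;> cases y.testBit i <;> rfl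
  have xor_mod (x y : ℕ) : (x ^^^ y) % 2 = (x % 2 + y % 2) % 2 := by
    have := Nat.xor_mod_two_eq (m := x) (n := y)
    omega
  have main : ∀ x ∈ xorSpan rows, ∀ y ∈ xorSpan rows, x % 2 = 1 → y % 2 = 0 →
      popCount (x ||| y) = 10 → x ||| y ∈ unionMasks := by
    intro x hx y hy hx1 hy0 hc
    rcases le_total x (x ^^^ y) with h | h
    · exact mem_unionMasks.2 ⟨x, hx, y, hy, hx1, hy0, hc, h, rfl⟩
    · refine mem_unionMasks.2 ⟨x ^^^ y, xor_mem_xorSpan rows x hx y hy, y, hy, ?_, hy0, ?_, ?_,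
        lor_xor x y⟩
      · rw [xor_mod, hx1, hy0]
      · rwa [lor_xor]
      · rwa [xor_xor]
  rw [hB S]
  constructor
  · rintro ⟨x, hx, y, hy, hc, rfl⟩
    refine ⟨x ||| y, ?_, rfl⟩
    rcases Nat.mod_two_eq_zero_or_one x with hx0 | hx1 <;>
      rcases Nat.mod_two_eq_zero_or_one y with hy0 | hy1
    · rw [mem_maskSet] at h0
      simp [Nat.testBit_zero, hx0, hy0] at h0
    · rw [Nat.lor_comm] at hc ⊢
      exact main y hy x hx hy1 hx0 hc
    · exact main x hx y hy hx1 hy0 hc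
    · rw [← lor_xor, Nat.lor_comm] at hc ⊢
      exact main y hy (x ^^^ y) (xor_mem_xorSpan rows x hx y hy) hy1
        (by rw [xor_mod, hx1, hy1]) hc
  · rintro ⟨s, hs, rfl⟩
    obtain ⟨x, hx, y, hy, -, -, hc, -, rfl⟩ := mem_unionMasks.1 hs
    exact ⟨x, hx, y, hy, hc, rfl⟩

lemma IsUnionFamily.ncard_eq_countAbove {B : Set (Finset (Fin 18))} (hB : IsUnionFamily B)
    {m : ℕ} (hm : m < 2 ^ 18) (h0 : m % 2 = 1) :
    {b ∈ B | maskSet m ⊆ b}.ncard = countAbove m unionMasks := by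
  have hlt : ∀ s ∈ unionMasks, s < 2 ^ 18 := by
    intro s hs
    obtain ⟨x, hx, y, hy, -, -, -, -, rfl⟩ := mem_unionMasks.1 hs
    exact lor_lt_of_mem hx hy
  set l := unionMasks.filter fun x => x &&& m == m with hl
  have hset : {b ∈ B | maskSet m ⊆ b} = maskSet '' {x | x ∈ l.toFinset} := by
    ext S
    simp only [Set.mem_ofPred_eq, Set.mem_image, List.mem_toFinset, hl, List.mem_filter,
      beq_iff_eq, land_eq_iff_maskSet_subset hm]
    constructor
    · rintro ⟨hS, hmS⟩
      have hS0 : 0 ∈ S := hmS (by simp [Nat.testBit_zero, h0])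
      obtain ⟨s, hs, rfl⟩ := (hB.mem_iff_of_zero_mem hS0).1 hS
      exact ⟨s, ⟨hs, hmS⟩, rfl⟩
    · rintro ⟨s, ⟨hs, hms⟩, rfl⟩
      have hS0 : 0 ∈ maskSet s := hms (by simp [Nat.testBit_zero, h0])
      exact ⟨(hB.mem_iff_of_zero_mem hS0).2 ⟨s, hs, rfl⟩, hms⟩
  rw [hset, Set.InjOn.ncard_image, countAbove_eq, ← hl]
  · change ((l.toFinset : Finset ℕ) : Set ℕ).ncard = _
    rw [Set.ncard_coe_finset, List.toFinset_card_of_nodup (nodup_unionMasks.filter _)]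
  · refine maskSet_injOn.mono fun s hs => ?_
    rw [Set.mem_ofPred_eq, List.mem_toFinset] at hs
    exact hlt s (List.mem_of_mem_filter hs)

lemma IsUnionFamily.ncard_of_card_three {B : Set (Finset (Fin 18))} (hB : IsUnionFamily B)
    {T : Finset (Fin 18)} (hT : T.card = 3) (h0 : 0 ∈ T) : {b ∈ B | T ⊆ b}.ncard = 315 := by
  obtain ⟨y, z, hy, hyz, rfl⟩ : ∃ y z : Fin 18, 0 < y ∧ y < z ∧ T = {0, y, z} := by
    have hT2 : (T.erase 0).card = 2 := by rw [Finset.card_erase_of_mem h0, hT]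
    obtain ⟨y, z, hyz, h⟩ := Finset.card_eq_two.1 hT2
    have hT' : T = {0, y, z} := by rw [← Finset.insert_erase h0, h]
    have hy : y ≠ 0 := (Finset.mem_erase.1 (h ▸ (by simp : y ∈ ({y, z} : Finset (Fin 18))))).1
    have hz : z ≠ 0 := (Finset.mem_erase.1 (h ▸ (by simp : z ∈ ({y, z} : Finset (Fin 18))))).1
    rcases lt_or_gt_of_ne hyz with hlt | hlt
    · exact ⟨y, z, Fin.pos_of_ne_zero hy, hlt, hT'⟩
    · exact ⟨z, y, Fin.pos_of_ne_zero hz, hlt, by rw [hT', Finset.pair_comm]⟩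
  have hmask : ∀ y z : Fin 18, 0 < y → y < z →
      (1 + 2 ^ y.val + 2 ^ z.val < 2 ^ 18 ∧ (1 + 2 ^ y.val + 2 ^ z.val) % 2 = 1) ∧
        ∀ i : Fin 18, (1 + 2 ^ y.val + 2 ^ z.val).testBit i = true ↔
          i = 0 ∨ i = y ∨ i = z := by
    decide +kernel
  obtain ⟨⟨hlt, hodd⟩, hbit⟩ := hmask y z hy hyz
  have hT : ({0, y, z} : Finset (Fin 18)) = maskSet (1 + 2 ^ y.val + 2 ^ z.val) := by
    ext i
    rw [mem_maskSet, hbit]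
    simp
  rw [hT, hB.ncard_eq_countAbove hlt hodd, countAbove_three y z hy hyz]

lemma IsUnionFamily.exists_ncard_ne {B : Set (Finset (Fin 18))} (hB : IsUnionFamily B) :
    ∃ T T' : Finset (Fin 18), T.card = 4 ∧ T'.card = 4 ∧
      {b ∈ B | T ⊆ b}.ncard ≠ {b ∈ B | T' ⊆ b}.ncard := by
  refine ⟨maskSet 15, maskSet 23, ?_, ?_, ?_⟩
  · rw [card_maskSet]
    decide +kernel
  · rw [card_maskSet]
    decide +kernel
  · rw [hB.ncard_eq_countAbove (by norm_num) (by norm_num),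
      hB.ncard_eq_countAbove (by norm_num) (by norm_num), countAbove_four.1, countAbove_four.2]
    norm_num

/-! ### The code as a row space -/

/-- The value at `x` of the polynomial over the field with two elements that generates the binary
quadratic residue code of length 17. -/
def qrGen {K : Type} [Field K] (x : K) : K := x ^ 8 + x ^ 5 + x ^ 4 + x ^ 3 + 1

lemma qrGen_sq {K : Type} [Field K] [CharP K 2] {x : K} (hx : qrGen x = 0) :
    qrGen (x ^ 2) = 0 := by
  have h2 : (2 : K) = 0 := CharTwo.two_eq_zero
  unfold qrGen at hx ⊢
  linear_combination (x ^ 8 + x ^ 5 + x ^ 4 + x ^ 3 + 1) * hx -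
    (x ^ 3 + x ^ 4 + x ^ 5 + x ^ 7 + 2 * x ^ 8 + x ^ 9 + x ^ 11 + x ^ 12 + x ^ 13) * h2

lemma qrGen_or_qrGen_cube {K : Type} [Field K] [CharP K 2] {x : K}
    (hx : IsPrimitiveRoot x 17) :
    qrGen x = 0 ∨ qrGen (x ^ 3) = 0 := by
  have h2 : (2 : K) = 0 := CharTwo.two_eq_zero
  have h17 : x ^ 17 = 1 := hx.pow_eq_one
  have h1 : x - 1 ≠ 0 := sub_ne_zero.2 (hx.ne_one (by norm_num))
  have hmul : (x - 1) * (qrGen x * (x ^ 8 + x ^ 7 + x ^ 6 + x ^ 4 + x ^ 2 + x + 1)) = 0 := by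
    unfold qrGen
    linear_combination h17 + (-x ^ 4 + x ^ 13) * h2
  rcases mul_eq_zero.1 ((mul_eq_zero.1 hmul).resolve_left h1) with h | hq
  · exact Or.inl h
  · refine Or.inr ?_
    unfold qrGen
    linear_combination (17 - 7 * x - 4 * x ^ 2 + 9 * x ^ 3 - 8 * x ^ 4 + 4 * x ^ 5 + x ^ 6 -
      4 * x ^ 7 + 5 * x ^ 8 - 2 * x ^ 9 - x ^ 10 + 2 * x ^ 11 - 2 * x ^ 12 + x ^ 13 - x ^ 15 +
      x ^ 16) * hq +
      (-8 - 5 * x - 3 * x ^ 2 + x ^ 3 - 7 * x ^ 4 + x ^ 5 - 5 * x ^ 6 - 10 * x ^ 7) * h2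

/-- The `i`-th row of the generator matrix. -/
def row (i : Fin 9) : ℕ := rows.get i

lemma pow_eq_sum_bit {K : Type} [Field K] [CharP K 2] {x : K} (hx : qrGen x = 0) (i : Fin 9) :
    x ^ (8 + i : ℕ) = ∑ j : Fin 8, bit K (row i) j * x ^ (j : ℕ) := by
  have h2 : (2 : K) = 0 := CharTwo.two_eq_zero
  unfold qrGen at hx
  have h8 : x ^ 8 = 1 + x ^ 3 + x ^ 4 + x ^ 5 := by
    linear_combination hx - (1 + x ^ 3 + x ^ 4 + x ^ 5) * h2
  have h9 : x ^ 9 = x + x ^ 4 + x ^ 5 + x ^ 6 := by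
    linear_combination x * h8
  have h10 : x ^ 10 = x ^ 2 + x ^ 5 + x ^ 6 + x ^ 7 := by
    linear_combination x * h9
  have h11 : x ^ 11 = 1 + x ^ 4 + x ^ 5 + x ^ 6 + x ^ 7 := by
    linear_combination x * h10 + h8 + (x ^ 3) * h2
  have h12 : x ^ 12 = 1 + x + x ^ 3 + x ^ 4 + x ^ 6 + x ^ 7 := by
    linear_combination x * h11 + h8 + (x ^ 5) * h2
  have h13 : x ^ 13 = 1 + x + x ^ 2 + x ^ 3 + x ^ 7 := by
    linear_combination x * h12 + h8 + (x ^ 4 + x ^ 5) * h2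
  have h14 : x ^ 14 = 1 + x + x ^ 2 + x ^ 5 := by
    linear_combination x * h13 + h8 + (x ^ 3 + x ^ 4) * h2
  have h15 : x ^ 15 = x + x ^ 2 + x ^ 3 + x ^ 6 := by
    linear_combination x * h14
  have h16 : x ^ 16 = x ^ 2 + x ^ 3 + x ^ 4 + x ^ 7 := by
    linear_combination x * h15
  fin_cases i <;>
    simp [Fin.sum_univ_succ, bit, row, rows, Nat.testBit, Nat.shiftRight_eq_div_pow, *] <;> ring

lemma charP_two_of_algebra_F4 (K : Type) [Field K] [Algebra F4 K] : CharP K 2 :=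
  charP_of_injective_algebraMap (algebraMap F4 K).injective 2

lemma qrGen_pow_two_pow {K : Type} [Field K] [CharP K 2] {x : K} (hx : qrGen x = 0) (k : ℕ) :
    qrGen (x ^ 2 ^ k) = 0 := by
  induction k with
  | zero => simpa using hx
  | succ k ih =>
    rw [pow_succ, pow_mul]
    exact qrGen_sq ih

lemma sum_mul_pow_eq {K : Type} [Field K] [CharP K 2] {x : K} (hx : qrGen x = 0)
    (c : Fin 17 → K) :
    ∑ i, c i * x ^ (i : ℕ) = ∑ j : Fin 8,
      (c (Fin.castAdd 9 j) + ∑ i : Fin 9, bit K (row i) j * c (Fin.natAdd 8 i)) * x ^ (j : ℕ) := by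
  have h : ∑ i, c i * x ^ (i : ℕ) = ∑ j : Fin 8, c (Fin.castAdd 9 j) * x ^ (j : ℕ) +
      ∑ i : Fin 9, c (Fin.natAdd 8 i) * x ^ (8 + i : ℕ) :=
    Fin.sum_univ_add (a := 8) (b := 9) fun i => c i * x ^ (i : ℕ)
  rw [h]
  simp only [pow_eq_sum_bit hx, add_mul, Finset.sum_add_distrib, Finset.mul_sum, Finset.sum_mul]
  rw [Finset.sum_comm]
  congr 1
  refine Finset.sum_congr rfl fun j _ => Finset.sum_congr rfl fun i _ => ?_
  ring

lemma forall_two_pow_iff_forall_isSquare (p : ℕ → Prop) :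
    (∀ ℓ : ZMod 17, ℓ ≠ 0 → IsSquare ℓ → p ℓ.val) ↔ ∀ k : Fin 8, p (2 ^ (k : ℕ) % 17) := by
  constructor
  · intro h k
    have hk : ∀ k : Fin 8, ((2 ^ (k : ℕ) : ℕ) : ZMod 17) ≠ 0 ∧
        ∃ r : ZMod 17, ((2 ^ (k : ℕ) : ℕ) : ZMod 17) = r * r := by decide
    have := h ((2 ^ (k : ℕ) : ℕ) : ZMod 17) (hk k).1 (hk k).2
    rwa [ZMod.val_natCast] at this
  · rintro h ℓ hℓ ⟨r, rfl⟩
    have hr : ∀ r : ZMod 17, r * r ≠ 0 → ∃ k : Fin 8, (r * r).val = 2 ^ (k : ℕ) % 17 := by decide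
    obtain ⟨k, hk⟩ := hr r hℓ
    rw [hk]
    exact h k

lemma qr4Mem_iff {K : Type} [Field K] [Algebra F4 K] {α : K} (hα : IsPrimitiveRoot α 17)
    (hg : qrGen α = 0) (c : Fin 17 → F4) :
    qr4Mem α c ↔ ∀ j : Fin 8,
      c (Fin.castAdd 9 j) = ∑ i : Fin 9, bit F4 (row i) j * c (Fin.natAdd 8 i) := by
  have := charP_two_of_algebra_F4 K
  set r : Fin 8 → F4 := fun j =>
    c (Fin.castAdd 9 j) + ∑ i : Fin 9, bit F4 (row i) j * c (Fin.natAdd 8 i) with hr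
  have hsum (k : ℕ) : ∑ i : Fin 17, algebraMap F4 K (c i) * (α ^ 2 ^ k) ^ (i : ℕ) =
      ∑ j : Fin 8, algebraMap F4 K (r j) * (α ^ 2 ^ k) ^ (j : ℕ) := by
    rw [sum_mul_pow_eq (qrGen_pow_two_pow hg k)]
    simp [hr, map_bit]
  have hinj : Function.Injective fun k : Fin 8 => α ^ 2 ^ (k : ℕ) := by
    intro k l hkl
    have h : α ^ (2 ^ (k : ℕ) % 17) = α ^ (2 ^ (l : ℕ) % 17) := by
      rw [← pow_eq_pow_mod _ hα.pow_eq_one, ← pow_eq_pow_mod _ hα.pow_eq_one]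
      exact hkl
    have key : ∀ k l : Fin 8, 2 ^ (k : ℕ) % 17 = 2 ^ (l : ℕ) % 17 → k = l := by decide
    exact key k l (hα.pow_inj (Nat.mod_lt _ (by norm_num)) (Nat.mod_lt _ (by norm_num)) h)
  have hiff : qr4Mem α c ↔
      ∀ k : Fin 8, ∑ j : Fin 8, algebraMap F4 K (r j) * (α ^ 2 ^ (k : ℕ)) ^ (j : ℕ) = 0 := by
    unfold qr4Mem
    rw [forall_two_pow_iff_forall_isSquare fun ℓ =>
      ∑ i : Fin 17, algebraMap F4 K (c i) * α ^ (ℓ * (i : ℕ)) = 0]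
    refine forall_congr' fun k => ?_
    rw [← hsum]
    simp only [pow_mul, ← pow_eq_pow_mod _ hα.pow_eq_one]
  rw [hiff]
  constructor
  · intro h j
    have h0 := Matrix.eq_zero_of_forall_index_sum_mul_pow_eq_zero hinj h
    have := congrFun h0 j
    simp only [Pi.zero_apply, map_eq_zero] at this
    exact CharTwo.add_eq_zero.1 this
  · intro h k
    have hr0 (j : Fin 8) : r j = 0 := CharTwo.add_eq_zero.2 (h j)
    simp [hr0]

/-- The sum of each row of the generator matrix over the first 17 columns is the entry in
the last column. -/
lemma sum_bit_row (i : Fin 9) : ∑ j : Fin 17, bit F4 (row i) j = bit F4 (row i) 17 := by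
  have h : ∀ i, ∑ j : Fin 17, bit (ZMod 2) (row i) j = bit (ZMod 2) (row i) 17 := by
    unfold bit
    decide +kernel
  simpa only [map_sum, map_bit] using congrArg (algebraMap (ZMod 2) F4) (h i)

/-- The position of the `i`-th information symbol. -/
def infoPos (i : Fin 9) : Fin 18 := ⟨8 + i, by omega⟩

lemma bit_row_infoPos (i k : Fin 9) (R : Type) [Zero R] [One R] :
    bit R (row i) (infoPos k) = if i = k then 1 else 0 := by
  have h : ∀ i k : Fin 9, (row i).testBit (infoPos k) = true ↔ i = k := by decide +kernel
  unfold bit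
  simp only [h]

lemma forall_fin_eighteen {p : Fin 18 → Prop} :
    (∀ j, p j) ↔ (∀ j : Fin 8, p (Fin.castAdd 9 j).castSucc) ∧
      (∀ i, p (infoPos i)) ∧ p (Fin.last 17) := by
  constructor
  · exact fun h => ⟨fun j => h _, fun i => h _, h _⟩
  · rintro ⟨h1, h2, h3⟩ j
    rcases lt_or_ge j.val 8 with h | h
    · exact h1 ⟨j, h⟩
    · rcases lt_or_ge j.val 17 with h' | h'
      · have : infoPos ⟨j - 8, by omega⟩ = j := Fin.ext (by simp [infoPos]; omega)
        exact this ▸ h2 _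
      · have : Fin.last 17 = j := Fin.ext (by simp; omega)
        exact this ▸ h3

lemma extQR4Mem_iff {K : Type} [Field K] [Algebra F4 K] {α : K} (hα : IsPrimitiveRoot α 17)
    (hg : qrGen α = 0) (c : Fin 18 → F4) :
    extQR4Mem α c ↔ ∀ j : Fin 18, c j = ∑ i, bit F4 (row i) j * c (infoPos i) := by
  have hinfo (k : Fin 9) : c (infoPos k) = ∑ i, bit F4 (row i) (infoPos k) * c (infoPos i) := by
    simp [bit_row_infoPos]
  have hlast (h : ∀ j : Fin 8, c (Fin.castAdd 9 j).castSucc =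
      ∑ i, bit F4 (row i) j * c (infoPos i)) :
      -∑ j : Fin 17, c j.castSucc = ∑ i, bit F4 (row i) 17 * c (infoPos i) := by
    have hc (j : Fin 17) : c j.castSucc = ∑ i, bit F4 (row i) j * c (infoPos i) := by
      rcases lt_or_ge j.val 8 with hj | hj
      · exact h ⟨j, hj⟩
      · have : infoPos ⟨j - 8, by omega⟩ = j.castSucc := Fin.ext (by simp [infoPos]; omega)
        have hj' := hinfo ⟨j - 8, by omega⟩
        rwa [this] at hj'
    rw [CharTwo.neg_eq, Finset.sum_congr rfl fun j _ => hc j, Finset.sum_comm]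
    simp only [← Finset.sum_mul, sum_bit_row]
  unfold extQR4Mem
  rw [qr4Mem_iff hα hg, forall_fin_eighteen]
  constructor
  · rintro ⟨h, h'⟩
    exact ⟨h, hinfo, h'.trans (hlast h)⟩
  · rintro ⟨h, -, h'⟩
    exact ⟨h, h'.trans (hlast h).symm⟩

lemma exists_mem_xorSpan_rows {a : Fin 18 → ZMod 2}
    (ha : ∀ j : Fin 18, a j = ∑ i, bit (ZMod 2) (row i) j * a (infoPos i)) :
    ∃ x ∈ xorSpan rows, ∀ j : Fin 18, bit (ZMod 2) x j = a j := by
  obtain ⟨x, hx, h⟩ := exists_mem_xorSpan_of_coeff rows (fun i => a (infoPos i))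
  refine ⟨x, hx, fun j => ?_⟩
  rw [h, ha]
  exact Finset.sum_congr rfl fun i _ => mul_comm _ _

lemma bit_eq_of_mem_xorSpan_rows {x : ℕ} (hx : x ∈ xorSpan rows) (j : Fin 18) :
    bit (ZMod 2) x j = ∑ i, bit (ZMod 2) (row i) j * bit (ZMod 2) x (infoPos i) := by
  obtain ⟨a, ha⟩ : ∃ a : Fin 9 → ZMod 2, ∀ j : ℕ,
      bit (ZMod 2) x j = ∑ i : Fin 9, a i * bit (ZMod 2) (row i) j :=
    exists_coeff_of_mem_xorSpan rows x hx
  have hinfo (k : Fin 9) : bit (ZMod 2) x (infoPos k) = a k := by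
    rw [ha]
    simp [bit_row_infoPos]
  simp only [hinfo]
  rw [ha]
  exact Finset.sum_congr rfl fun i _ => mul_comm _ _

/-- The set of supports of the codewords of weight ten. -/
def tenSupports {K : Type} [Field K] [Algebra F4 K] (α : K) : Set (Finset (Fin 18)) :=
  {s | ∃ c : Fin 18 → F4, extQR4Mem α c ∧ wt c = 10 ∧ supp c = s}

lemma isUnionFamily_tenSupports {K : Type} [Field K] [Algebra F4 K] {α : K}
    (hα : IsPrimitiveRoot α 17) (hg : qrGen α = 0) : IsUnionFamily (tenSupports α) := by
  have e : F4 ≃ₗ[ZMod 2] ZMod 2 × ZMod 2 :=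
    LinearEquiv.ofFinrankEq _ _ (by rw [GaloisField.finrank 2 (by norm_num)]; simp)
  have he (x j : ℕ) (t : F4) : e (bit F4 x j * t) =
      (bit (ZMod 2) x j * (e t).1, bit (ZMod 2) x j * (e t).2) := by
    unfold bit
    split_ifs
    · simp
    · simp
      rfl
  have hcode (c : Fin 18 → F4) : extQR4Mem α c ↔
      (∀ j : Fin 18, (e (c j)).1 = ∑ i, bit (ZMod 2) (row i) j * (e (c (infoPos i))).1) ∧
      ∀ j : Fin 18, (e (c j)).2 = ∑ i, bit (ZMod 2) (row i) j * (e (c (infoPos i))).2 := by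
    rw [extQR4Mem_iff hα hg, ← forall_and]
    refine forall_congr' fun j => ?_
    rw [← e.injective.eq_iff, map_sum]
    simp only [he, Prod.ext_iff, Prod.fst_sum, Prod.snd_sum]
  have hsupp {c : Fin 18 → F4} {x y : ℕ} (hx : ∀ j : Fin 18, bit (ZMod 2) x j = (e (c j)).1)
      (hy : ∀ j : Fin 18, bit (ZMod 2) y j = (e (c j)).2) : supp c = maskSet (x ||| y) := by
    ext j
    rw [mem_maskSet, Nat.testBit_or, Bool.or_eq_true, ← bit_ne_zero_iff, ← bit_ne_zero_iff,
      hx, hy, supp, Finset.mem_filter, ← e.map_ne_zero_iff, Ne, Prod.ext_iff, not_and_or]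
    simp
  intro S
  constructor
  · rintro ⟨c, hc, hwt, rfl⟩
    obtain ⟨h1, h2⟩ := (hcode c).1 hc
    obtain ⟨x, hx, hxc⟩ := exists_mem_xorSpan_rows h1
    obtain ⟨y, hy, hyc⟩ := exists_mem_xorSpan_rows h2
    refine ⟨x, hx, y, hy, ?_, hsupp hxc hyc⟩
    rw [← card_maskSet, ← hsupp hxc hyc]
    exact hwt
  · rintro ⟨x, hx, y, hy, hc, rfl⟩
    let c : Fin 18 → F4 := fun j => e.symm (bit (ZMod 2) x j, bit (ZMod 2) y j)
    have hS : supp c = maskSet (x ||| y) := hsupp (by simp [c]) (by simp [c])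
    refine ⟨c, (hcode c).2 ⟨fun j => ?_, fun j => ?_⟩, ?_, hS⟩
    · simpa [c] using bit_eq_of_mem_xorSpan_rows hx j
    · simpa [c] using bit_eq_of_mem_xorSpan_rows hy j
    · rw [← hc, ← card_maskSet, ← hS]
      rfl

/-! ### Coordinate permutations -/

/-- The permutation of the coordinates of the extended code that extends a permutation of the
first 17 coordinates and fixes the last one. -/
def extendPerm (e : Equiv.Perm (Fin 17)) : Equiv.Perm (Fin 18) :=
  finSuccEquivLast.symm.permCongr e.optionCongr

@[simp] lemma extendPerm_castSucc (e : Equiv.Perm (Fin 17)) (i : Fin 17) :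
    extendPerm e i.castSucc = (e i).castSucc := by
  simp [extendPerm, Equiv.permCongr_apply]

@[simp] lemma extendPerm_last (e : Equiv.Perm (Fin 17)) :
    extendPerm e (Fin.last 17) = Fin.last 17 := by
  rw [extendPerm, Equiv.permCongr_apply, Equiv.symm_symm, finSuccEquivLast_last]
  exact finSuccEquivLast_symm_none

lemma extQR4Mem_comp_extendPerm {K : Type} [Field K] [Algebra F4 K] {α β : K}
    {e : Equiv.Perm (Fin 17)} (h : ∀ c, qr4Mem α c ↔ qr4Mem β (c ∘ e)) (c : Fin 18 → F4) :
    extQR4Mem α c ↔ extQR4Mem β (c ∘ extendPerm e) := by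
  unfold extQR4Mem
  rw [h]
  simp only [Function.comp_def, extendPerm_castSucc, extendPerm_last]
  rw [Equiv.sum_comp e fun i => c i.castSucc]

lemma supp_comp {n : ℕ} {F : Type} [Zero F] (c : Fin n → F) (σ : Equiv.Perm (Fin n)) :
    supp (c ∘ σ) = (supp c).map σ.symm.toEmbedding := by
  ext i
  simp [supp, Finset.mem_map_equiv]

lemma mem_tenSupports_iff_map_mem {K : Type} [Field K] [Algebra F4 K] {α β : K}
    {e : Equiv.Perm (Fin 17)} (h : ∀ c, qr4Mem α c ↔ qr4Mem β (c ∘ e)) (S : Finset (Fin 18)) :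
    S ∈ tenSupports α ↔ S.map (extendPerm e).symm.toEmbedding ∈ tenSupports β := by
  constructor
  · rintro ⟨c, hc, hwt, rfl⟩
    refine ⟨c ∘ extendPerm e, (extQR4Mem_comp_extendPerm h c).1 hc, ?_, supp_comp c _⟩
    change (supp _).card = 10
    rw [supp_comp, Finset.card_map]
    exact hwt
  · rintro ⟨c, hc, hwt, hS⟩
    have hcc : (c ∘ (extendPerm e).symm) ∘ extendPerm e = c := by
      ext i
      simp
    have hsupp : supp (c ∘ (extendPerm e).symm) = S := by
      rw [supp_comp, hS]
      ext i
      simp [Finset.mem_map_equiv]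
    refine ⟨c ∘ (extendPerm e).symm, (extQR4Mem_comp_extendPerm h _).2 (hcc.symm ▸ hc), ?_,
      hsupp⟩
    change (supp _).card = 10
    rw [supp_comp, Finset.card_map]
    exact hwt

lemma ncard_tenSupports_map {K : Type} [Field K] [Algebra F4 K] {α β : K}
    {e : Equiv.Perm (Fin 17)} (h : ∀ c, qr4Mem α c ↔ qr4Mem β (c ∘ e)) (T : Finset (Fin 18)) :
    {b ∈ tenSupports α | T ⊆ b}.ncard =
      {b ∈ tenSupports β | T.map (extendPerm e).symm.toEmbedding ⊆ b}.ncard := by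
  have hset : {b ∈ tenSupports β | T.map (extendPerm e).symm.toEmbedding ⊆ b} =
      Finset.map (extendPerm e).symm.toEmbedding '' {b ∈ tenSupports α | T ⊆ b} := by
    ext S
    constructor
    · rintro ⟨hS, hT⟩
      have hSS : (S.map (extendPerm e).toEmbedding).map (extendPerm e).symm.toEmbedding = S := by
        ext i
        simp [Finset.mem_map_equiv]
      refine ⟨S.map (extendPerm e).toEmbedding, ⟨?_, ?_⟩, hSS⟩
      · rwa [mem_tenSupports_iff_map_mem h, hSS]
      · rwa [← hSS, Finset.map_subset_map] at hT
    · rintro ⟨S, ⟨hS, hT⟩, rfl⟩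
      exact ⟨(mem_tenSupports_iff_map_mem h S).1 hS, Finset.map_subset_map.2 hT⟩
  rw [hset, Set.ncard_image_of_injective _ (Finset.map_injective _)]

lemma qr4Mem_comp_addRight {K : Type} [Field K] [Algebra F4 K] {α : K} (hα : α ^ 17 = 1)
    (k : Fin 17) (c : Fin 17 → F4) : qr4Mem α c ↔ qr4Mem α (c ∘ Equiv.addRight k) := by
  have hα0 : α ≠ 0 := by
    rintro rfl
    norm_num at hα
  refine forall_congr' fun ℓ => imp_congr_right fun _ => imp_congr_right fun _ => ?_
  have hpow : (α ^ ℓ.val) ^ 17 = 1 := by rw [← pow_mul, mul_comm, pow_mul, hα, one_pow]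
  have hsum : ∑ i : Fin 17, algebraMap F4 K (c i) * α ^ (ℓ.val * (i : ℕ)) =
      (α ^ ℓ.val) ^ (k : ℕ) *
        ∑ i : Fin 17, algebraMap F4 K ((c ∘ Equiv.addRight k) i) * α ^ (ℓ.val * (i : ℕ)) := by
    rw [← Equiv.sum_comp (Equiv.addRight k), Finset.mul_sum]
    refine Finset.sum_congr rfl fun i _ => ?_
    rw [Function.comp_apply, pow_mul, pow_mul, Equiv.coe_addRight, Fin.val_add,
      ← pow_eq_pow_mod _ hpow, pow_add]
    ring
  rw [hsum]
  exact mul_eq_zero_iff_left (pow_ne_zero _ (pow_ne_zero _ hα0))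

/-- Multiplication by three on `Fin 17`. -/
def mulThree : Equiv.Perm (Fin 17) where
  toFun i := 3 * i
  invFun i := 6 * i
  left_inv := by decide
  right_inv := by decide

lemma qr4Mem_comp_mulThree {K : Type} [Field K] [Algebra F4 K] {α : K} (hα : α ^ 17 = 1)
    (c : Fin 17 → F4) : qr4Mem α c ↔ qr4Mem (α ^ 3) (c ∘ mulThree) := by
  refine forall_congr' fun ℓ => imp_congr_right fun _ => imp_congr_right fun _ => ?_
  have hpow : (α ^ ℓ.val) ^ 17 = 1 := by rw [← pow_mul, mul_comm, pow_mul, hα, one_pow]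
  rw [← Equiv.sum_comp mulThree]
  refine Eq.congr_left (Finset.sum_congr rfl fun i _ => ?_)
  have hval : (mulThree i).val = 3 * i.val % 17 := Fin.val_mul 3 i
  rw [Function.comp_apply, pow_mul, hval, ← pow_eq_pow_mod _ hpow, ← pow_mul, ← pow_mul]
  ring_nf

lemma ncard_tenSupports_of_qrGen_eq_zero {K : Type} [Field K] [Algebra F4 K] {α : K}
    (hα : IsPrimitiveRoot α 17) (hg : qrGen α = 0) {T : Finset (Fin 18)} (hT : T.card = 3) :
    {b ∈ tenSupports α | T ⊆ b}.ncard = 315 := by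
  obtain ⟨k, hk⟩ : ∃ k : Fin 17, k.castSucc ∈ T := by
    by_contra! h
    have hsub : T ⊆ {Fin.last 17} := by
      intro i hi
      induction i using Fin.lastCases with
      | last => simp
      | cast i => exact absurd hi (h i)
    have := Finset.card_le_card hsub
    simp [hT] at this
  rw [ncard_tenSupports_map (qr4Mem_comp_addRight hα.pow_eq_one k)]
  refine (isUnionFamily_tenSupports hα hg).ncard_of_card_three (by rw [Finset.card_map, hT]) ?_
  rw [Finset.mem_map_equiv, Equiv.symm_symm]
  have : extendPerm (Equiv.addRight k) 0 = k.castSucc := by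
    rw [← Fin.castSucc_zero, extendPerm_castSucc]
    simp
  rwa [this]

/-- For the extended quaternary quadratic residue code `C` of length 18, the set
`B = {supp c : c ∈ C, wt c = 10}` of distinct supports of weight-10 codewords is a simple
combinatorial `3`-`(18, 10, 315)` design (every 3-element subset of the coordinates lies in
exactly 315 members of `B`) but not a 4-design (some two 4-element subsets lie in different
numbers of members of `B`). -/
theorem quaternary_supports_ten_simple_design (K : Type) [Field K] [Algebra F4 K] (α : K)
    (hα : IsPrimitiveRoot α 17) :
    (∀ T : Finset (Fin 18), T.card = 3 →
      {b ∈ {s : Finset (Fin 18) | ∃ c : Fin 18 → F4, extQR4Mem α c ∧ wt c = 10 ∧ supp c = s} |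
        T ⊆ b}.ncard = 315) ∧
    (∃ T T' : Finset (Fin 18), T.card = 4 ∧ T'.card = 4 ∧
      {b ∈ {s : Finset (Fin 18) | ∃ c : Fin 18 → F4, extQR4Mem α c ∧ wt c = 10 ∧ supp c = s} |
        T ⊆ b}.ncard ≠
      {b ∈ {s : Finset (Fin 18) | ∃ c : Fin 18 → F4, extQR4Mem α c ∧ wt c = 10 ∧ supp c = s} |
        T' ⊆ b}.ncard) := by

  change (∀ T : Finset (Fin 18), T.card = 3 → {b ∈ tenSupports α | T ⊆ b}.ncard = 315) ∧
    ∃ T T' : Finset (Fin 18), T.card = 4 ∧ T'.card = 4 ∧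
      {b ∈ tenSupports α | T ⊆ b}.ncard ≠ {b ∈ tenSupports α | T' ⊆ b}.ncard
  have := charP_two_of_algebra_F4 K
  rcases qrGen_or_qrGen_cube hα with hg | hg
  · exact ⟨fun T hT => ncard_tenSupports_of_qrGen_eq_zero hα hg hT,
      (isUnionFamily_tenSupports hα hg).exists_ncard_ne⟩
  · have hα3 : IsPrimitiveRoot (α ^ 3) 17 := hα.pow_of_coprime 3 (by norm_num)
    have hmap := ncard_tenSupports_map (qr4Mem_comp_mulThree hα.pow_eq_one)
    refine ⟨fun T hT => ?_, ?_⟩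
    · rw [hmap]
      exact ncard_tenSupports_of_qrGen_eq_zero hα3 hg (by rw [Finset.card_map, hT])
    · obtain ⟨T, T', hT, hT', hne⟩ := (isUnionFamily_tenSupports hα3 hg).exists_ncard_ne
      have hcancel (T : Finset (Fin 18)) : (T.map (extendPerm mulThree).toEmbedding).map
          (extendPerm mulThree).symm.toEmbedding = T := by
        ext i
        simp [Finset.mem_map_equiv]
      refine ⟨T.map (extendPerm mulThree).toEmbedding, T'.map (extendPerm mulThree).toEmbedding,
        by rw [Finset.card_map, hT], by rw [Finset.card_map, hT'], ?_⟩
      rwa [hmap, hmap, hcancel, hcancel]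
end
end

section
/- Let C be the extended ternary quadratic residue code of length 14 and let Aut(C) = {σ ∈ S_14 : permuting the coordinates of every codeword of C by σ again yields a codeword of C}. Then the induced action of Aut(C) on the set of 3-element subsets of {1,…,14} has exactly 8 orbits. -/
open scoped Classical

noncomputable section

/-- Membership in the ternary quadratic residue code of length 13: the codeword, viewed
as the polynomial `∑ cᵢ Xⁱ` modulo `X ^ 13 - 1`, lies in the ideal generated by the
polynomial whose roots are `α ^ ℓ` for `ℓ` running over the nonzero squares mod 13;
equivalently (as that generator is separable and divides `X ^ 13 - 1`), the codeword
polynomial vanishes at `α ^ ℓ` for every nonzero square `ℓ` modulo 13. -/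
def qr3Mem {K : Type} [Field K] [Algebra (ZMod 3) K] (α : K) (c : Fin 13 → ZMod 3) : Prop :=
  ∀ ℓ : ZMod 13, ℓ ≠ 0 → IsSquare ℓ →
    ∑ i : Fin 13, algebraMap (ZMod 3) K (c i) * α ^ (ℓ.val * (i : ℕ)) = 0

/-- Membership in the extended ternary quadratic residue code of length 14: the first 13
coordinates form a codeword of the quadratic residue code of length 13 and the last
coordinate is minus the sum of the first 13. -/
def extQR3Mem {K : Type} [Field K] [Algebra (ZMod 3) K] (α : K) (c : Fin 14 → ZMod 3) : Prop :=
  qr3Mem α (fun i => c i.castSucc) ∧ c (Fin.last 13) = - ∑ i : Fin 13, c i.castSucc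

/-- The nonzero squares modulo 13 (`true`) and the non-squares modulo 13 (`false`). -/
def quadClass : Bool → Finset (ZMod 13)
  | true => {1, 3, 4, 9, 10, 12}
  | false => {2, 5, 6, 7, 8, 11}

/-- The coordinate of a residue class modulo 13 in a word of length 14. -/
def residuePoint (x : ZMod 13) : Fin 14 :=
  Fin.castSucc (n := 13) x

theorem ne_zero_and_isSquare_iff (ℓ : ZMod 13) : ℓ ≠ 0 ∧ IsSquare ℓ ↔ ℓ ∈ quadClass true := by
  have h : ∀ ℓ : ZMod 13, (ℓ ≠ 0 ∧ ∃ r, ℓ = r * r) ↔ ℓ ∈ quadClass true := by decide +kernel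
  exact h ℓ

theorem image_mul_quadClass (a : ZMod 13) (ha : a ∈ quadClass true) (b : Bool) :
    (quadClass b).image (a * ·) = quadClass b := by
  revert a b
  decide +kernel

theorem image_mul_quadClass_not (a : ZMod 13) (ha : a ∈ quadClass false) (b : Bool) :
    (quadClass b).image (a * ·) = quadClass (!b) := by
  revert a b
  decide +kernel

theorem mul_left_injective_of_mem_quadClass {a : ZMod 13} {b : Bool} (ha : a ∈ quadClass b) :
    Function.Injective (a * ·) := by
  have h : ∀ (b : Bool), ∀ a ∈ quadClass b, a ≠ 0 := by decide +kernel
  have : Fact (Nat.Prime 13) := ⟨by norm_num⟩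
  exact mul_right_injective₀ (h b a ha)

section Fourier

variable {K : Type} [Field K]

theorem three_eq_zero_of_algebra (K : Type) [Field K] [Algebra (ZMod 3) K] : (3 : K) = 0 := by
  have h := congrArg (algebraMap (ZMod 3) K) (show (3 : ZMod 3) = 0 from rfl)
  simpa only [map_ofNat, map_zero] using h

/-- In characteristic 3 one of the two quadratic Gauss periods modulo 13 vanishes and the other
one is `-1`. -/
theorem exists_gaussPeriod [Algebra (ZMod 3) K] {α : K} (hα : IsPrimitiveRoot α 13)
    (ψ : AddChar (ZMod 13) K)
    (hψ : ∀ x : ZMod 13, ψ x = α ^ x.val) :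
    ∃ b : Bool, ∑ d ∈ quadClass b, ψ d = -1 ∧ ∑ d ∈ quadClass (!b), ψ d = 0 := by
  have h3 := three_eq_zero_of_algebra K
  have h13 := hα.pow_eq_one
  have hs := hα.geom_sum_eq_zero (by norm_num)
  have hR : ∑ d ∈ quadClass true, ψ d = α + α ^ 3 + α ^ 4 + α ^ 9 + α ^ 10 + α ^ 12 := by
    simp_rw [hψ]
    have : (quadClass true) = {1, 3, 4, 9, 10, 12} := rfl
    rw [this]
    repeat rw [Finset.sum_insert (by decide)]
    rw [Finset.sum_singleton]
    change α ^ 1 + (α ^ 3 + (α ^ 4 + (α ^ 9 + (α ^ 10 + α ^ 12)))) = _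
    ring
  have hN : ∑ d ∈ quadClass false, ψ d = α ^ 2 + α ^ 5 + α ^ 6 + α ^ 7 + α ^ 8 + α ^ 11 := by
    simp_rw [hψ]
    have : (quadClass false) = {2, 5, 6, 7, 8, 11} := rfl
    rw [this]
    repeat rw [Finset.sum_insert (by decide)]
    rw [Finset.sum_singleton]
    change α ^ 2 + (α ^ 5 + (α ^ 6 + (α ^ 7 + (α ^ 8 + α ^ 11)))) = _
    ring
  simp only [Finset.sum_range_succ, Finset.sum_range_zero] at hs
  have hadd : ∑ d ∈ quadClass true, ψ d + ∑ d ∈ quadClass false, ψ d = -1 := by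
    rw [hR, hN]
    linear_combination hs
  have hmul : (∑ d ∈ quadClass true, ψ d) * ∑ d ∈ quadClass false, ψ d = 0 := by
    rw [hR, hN]
    linear_combination
      (3 * α + 3 * α ^ 2 + 2 * α ^ 3 + 3 * α ^ 4 + 2 * α ^ 5 + α ^ 6 + 2 * α ^ 7 + α ^ 8 +
        α ^ 10) * h13 +
      (α + α ^ 2 + α ^ 3 + α ^ 4 + α ^ 5 + α ^ 6 + α ^ 7 + α ^ 8 + α ^ 9 + α ^ 10 + α ^ 11 +
        α ^ 12) * h3
  rcases mul_eq_zero.mp hmul with h | h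
  · exact ⟨false, by rw [h, zero_add] at hadd; exact hadd, h⟩
  · exact ⟨true, by rw [h, add_zero] at hadd; exact hadd, h⟩

theorem sum_quadClass_mul (ψ : ZMod 13 → K) {a : ZMod 13} {b b' : Bool}
    (ha : a ∈ quadClass b') :
    ∑ d ∈ quadClass b, ψ (a * d) = ∑ d ∈ (quadClass b).image (a * ·), ψ d :=
  (Finset.sum_image (mul_left_injective_of_mem_quadClass ha).injOn).symm

theorem sum_correlation_quadClass (ψ : AddChar (ZMod 13) K) (c : ZMod 13 → K) (ℓ : ZMod 13)
    (b : Bool) :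
    ∑ j, (∑ d ∈ quadClass b, c (j + d)) * ψ (ℓ * j) =
      (∑ d ∈ quadClass b, ψ (ℓ * d)) * ∑ i, c i * ψ (ℓ * i) := by
  have hneg : ∑ d ∈ quadClass b, ψ (ℓ * d) = ∑ d ∈ quadClass b, ψ (ℓ * -d) := by
    have h := sum_quadClass_mul (b := b) (b' := true) (fun x => ψ (ℓ * x))
      (show (-1 : ZMod 13) ∈ _ by decide)
    rw [image_mul_quadClass _ (by decide)] at h
    simpa using h.symm
  rw [hneg, Finset.sum_mul]
  simp_rw [Finset.sum_mul]
  rw [Finset.sum_comm]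
  refine Finset.sum_congr rfl fun d _ => ?_
  rw [Finset.mul_sum]
  refine Fintype.sum_equiv (Equiv.addRight d) _ _ fun j => ?_
  have : ψ (ℓ * j) = ψ (ℓ * -d) * ψ (ℓ * (j + d)) := by
    rw [← AddChar.map_add_eq_mul]
    congr 1
    ring
  rw [Equiv.coe_addRight, this]
  ring

/-- The words of length 14 satisfying the parity checks given by the translates of a quadratic
class modulo 13, the last coordinate being minus the sum of the others. -/
def ParityCheck (b : Bool) (c : Fin 14 → ZMod 3) : Prop :=
  (∀ j : ZMod 13, ∑ d ∈ quadClass b, c (residuePoint (j + d)) = 0) ∧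
    c (Fin.last 13) = - ∑ i : Fin 13, c i.castSucc

theorem exists_extQR3Mem_iff_parityCheck [Algebra (ZMod 3) K] {α : K}
    (hα : IsPrimitiveRoot α 13) :
    ∃ b, ∀ c, extQR3Mem α c ↔ ParityCheck b c := by
  let ψ : AddChar (ZMod 13) K := AddChar.zmodChar 13 hα.pow_eq_one
  have hψ (x : ZMod 13) : ψ x = α ^ x.val := AddChar.zmodChar_apply _ x
  have hψ' (ℓ i : ZMod 13) : α ^ (ℓ.val * i.val) = ψ (ℓ * i) := by
    rw [hψ, ZMod.val_mul, ← pow_mod_orderOf, ← hα.eq_orderOf]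
  have hinj : Function.Injective fun ℓ : Fin 13 => α ^ (ℓ : ℕ) := fun i j h =>
    Fin.ext (hα.pow_inj i.isLt j.isLt h)
  obtain ⟨b, hb, hb'⟩ := exists_gaussPeriod hα ψ hψ
  refine ⟨b, fun c => and_congr_left fun _ => ?_⟩
  set f : ZMod 13 → K := fun i => algebraMap (ZMod 3) K (c (residuePoint i)) with hf
  have hmem : qr3Mem α (fun i => c i.castSucc) ↔
      ∀ ℓ ∈ quadClass true, ∑ i, f i * ψ (ℓ * i) = 0 := by
    unfold qr3Mem
    refine forall_congr' fun ℓ => ?_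
    rw [← ne_zero_and_isSquare_iff, and_imp]
    refine imp_congr_right fun _ => imp_congr_right fun _ => ?_
    simp_rw [← hψ']
    rfl
  have hchk (j : ZMod 13) : (∑ d ∈ quadClass b, c (residuePoint (j + d)) = 0) ↔
      ∑ d ∈ quadClass b, f (j + d) = 0 := by
    rw [← map_eq_zero (algebraMap (ZMod 3) K), map_sum]
  simp_rw [hchk]
  rw [hmem]
  constructor
  · intro h
    have hall (ℓ : ZMod 13) : ∑ j, (∑ d ∈ quadClass b, f (j + d)) * ψ (ℓ * j) = 0 := by
      rw [sum_correlation_quadClass]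
      have hℓ : ℓ = 0 ∨ ℓ ∈ quadClass true ∨ ℓ ∈ quadClass false := by
        revert ℓ
        decide
      rcases hℓ with rfl | hℓ | hℓ
      · have hcard : (quadClass b).card = 6 := by cases b <;> rfl
        have h6 : (6 : K) = 0 := by linear_combination 2 * three_eq_zero_of_algebra K
        simp [hcard, h6]
      · rw [h ℓ hℓ, mul_zero]
      · rw [sum_quadClass_mul _ hℓ, image_mul_quadClass_not _ hℓ, hb', zero_mul]
    have hzero := Matrix.eq_zero_of_forall_index_sum_pow_mul_eq_zero
      (n := 13) (v := fun j => ∑ d ∈ quadClass b, f (id (α := ZMod 13) j + d)) hinj fun ℓ => by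
        rw [← hall ℓ]
        refine Finset.sum_congr rfl fun (j : ZMod 13) _ => ?_
        rw [mul_comm, ← hψ' ℓ j, pow_mul]
        rfl
    exact fun j => congrFun hzero j
  · intro h ℓ hℓ
    have key := sum_correlation_quadClass ψ f ℓ b
    simp_rw [h, zero_mul, Finset.sum_const_zero] at key
    rw [sum_quadClass_mul _ hℓ, image_mul_quadClass _ hℓ, hb] at key
    simpa using key

end Fourier

/-- The monoid of coordinate permutations under which a set of words is stable. -/
def stableMonoid (C : (Fin 14 → ZMod 3) → Prop) : Submonoid (Equiv.Perm (Fin 14)) where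
  carrier := {σ | ∀ c, C c → C (c ∘ σ)}
  mul_mem' := fun {_ _} hσ hτ c hc => hτ _ (hσ c hc)
  one_mem' := fun _ hc => hc

theorem inv_mem_stableMonoid {C : (Fin 14 → ZMod 3) → Prop} {σ : Equiv.Perm (Fin 14)}
    (hσ : σ ∈ stableMonoid C) : σ⁻¹ ∈ stableMonoid C := by
  have h : σ ^ (orderOf σ - 1) = σ⁻¹ := by
    rw [eq_inv_iff_mul_eq_one, ← pow_succ, Nat.sub_add_cancel (orderOf_pos σ), pow_orderOf_eq_one]
  exact h ▸ pow_mem hσ _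

/-- The orbit of a set of coordinates under the permutations stabilising `C`. -/
def stableOrbit (C : (Fin 14 → ZMod 3) → Prop) (T : Finset (Fin 14)) : Set (Finset (Fin 14)) :=
  {T' | ∃ σ ∈ stableMonoid C, T.image σ = T'}

theorem mem_stableOrbit_self (C : (Fin 14 → ZMod 3) → Prop) (T : Finset (Fin 14)) :
    T ∈ stableOrbit C T :=
  ⟨1, one_mem _, by simp⟩

theorem stableOrbit_image {C : (Fin 14 → ZMod 3) → Prop} {σ : Equiv.Perm (Fin 14)}
    (hσ : σ ∈ stableMonoid C) (T : Finset (Fin 14)) :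
    stableOrbit C (T.image σ) = stableOrbit C T := by
  ext T'
  constructor
  · rintro ⟨τ, hτ, rfl⟩
    exact ⟨τ * σ, mul_mem hτ hσ, by rw [Finset.image_image]; rfl⟩
  · rintro ⟨τ, hτ, rfl⟩
    refine ⟨τ * σ⁻¹, mul_mem hτ (inv_mem_stableMonoid hσ), ?_⟩
    rw [Finset.image_image]
    congr 1
    ext x
    simp

/-- The 6-element sets of coordinates whose indicator word belongs to `C`. -/
def sextets (C : (Fin 14 → ZMod 3) → Prop) : Finset (Finset (Fin 14)) :=
  {S ∈ Finset.univ.powersetCard 6 | C fun i => if i ∈ S then 1 else 0}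

theorem image_mem_sextets {C : (Fin 14 → ZMod 3) → Prop} {σ : Equiv.Perm (Fin 14)}
    (hσ : σ ∈ stableMonoid C) {S : Finset (Fin 14)} (hS : S ∈ sextets C) :
    S.image σ ∈ sextets C := by
  simp only [sextets, Finset.mem_filter, Finset.mem_powersetCard_univ] at hS ⊢
  refine ⟨by rw [Finset.card_image_of_injective _ σ.injective, hS.1], ?_⟩
  convert inv_mem_stableMonoid hσ _ hS.2 using 2 with i
  have : i ∈ S.image σ ↔ σ⁻¹ i ∈ S := by
    simp [Finset.mem_image, ← Equiv.Perm.eq_inv_iff_eq]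
  simp only [this, Function.comp_apply]

/-- The numbers of members of `𝓑` disjoint from `T` and containing `T`. -/
def intersectionType (𝓑 : Finset (Finset (Fin 14))) (T : Finset (Fin 14)) : ℕ × ℕ :=
  ((𝓑.filter fun S => T ∩ S = ∅).card, (𝓑.filter fun S => T ⊆ S).card)

theorem intersectionType_image {C : (Fin 14 → ZMod 3) → Prop} {σ : Equiv.Perm (Fin 14)}
    (hσ : σ ∈ stableMonoid C) (T : Finset (Fin 14)) :
    intersectionType (sextets C) (T.image σ) = intersectionType (sextets C) T := by
  have hmaps {S} (hS : S ∈ sextets C) : S.image σ.symm ∈ sextets C :=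
    image_mem_sextets (inv_mem_stableMonoid hσ) hS
  have hl (S : Finset (Fin 14)) : (S.image σ).image σ.symm = S := by
    simp [Finset.image_image]
  have hr (S : Finset (Fin 14)) : (S.image σ.symm).image σ = S := by
    simp [Finset.image_image]
  refine congrArg₂ Prod.mk ?_ ?_
  · refine Finset.card_nbij' (Finset.image σ.symm) (Finset.image σ) ?_ ?_
      (fun S _ => hr S) (fun S _ => hl S)
    · intro S hS
      simp only [Finset.coe_filter, Set.mem_ofPred_eq] at hS ⊢
      refine ⟨hmaps hS.1, ?_⟩
      have := congrArg (Finset.image σ.symm) hS.2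
      rwa [Finset.image_inter _ _ σ.symm.injective, hl, Finset.image_empty] at this
    · intro S hS
      simp only [Finset.coe_filter, Set.mem_ofPred_eq] at hS ⊢
      refine ⟨image_mem_sextets hσ hS.1, ?_⟩
      rw [← Finset.image_inter _ _ σ.injective, hS.2, Finset.image_empty]
  · refine Finset.card_nbij' (Finset.image σ.symm) (Finset.image σ) ?_ ?_
      (fun S _ => hr S) (fun S _ => hl S)
    · intro S hS
      simp only [Finset.coe_filter, Set.mem_ofPred_eq] at hS ⊢
      refine ⟨hmaps hS.1, ?_⟩
      have := Finset.image_subset_image (f := σ.symm) hS.2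
      rwa [hl] at this
    · intro S hS
      simp only [Finset.coe_filter, Set.mem_ofPred_eq] at hS ⊢
      exact ⟨image_mem_sextets hσ hS.1, Finset.image_subset_image hS.2⟩

/-- The coordinate map `x ↦ a * x + t` fixing the last coordinate. -/
def affineMap (a t : ZMod 13) : Fin 14 → Fin 14 :=
  Fin.lastCases (Fin.last 13) fun x => residuePoint (a * id (α := ZMod 13) x + t)

theorem affineMap_residuePoint (a t x : ZMod 13) :
    affineMap a t (residuePoint x) = residuePoint (a * x + t) :=
  Fin.lastCases_castSucc ..

theorem affineMap_last (a t : ZMod 13) : affineMap a t (Fin.last 13) = Fin.last 13 :=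
  Fin.lastCases_last ..

theorem affineMap_affineMap (a t a' t' : ZMod 13) (i : Fin 14) :
    affineMap a t (affineMap a' t' i) = affineMap (a * a') (a * t' + t) i := by
  have h (x : ZMod 13) : affineMap a t (affineMap a' t' (residuePoint x)) =
      affineMap (a * a') (a * t' + t) (residuePoint x) := by
    simp_rw [affineMap_residuePoint]
    congr 1
    ring
  induction i using Fin.lastCases with
  | last => simp_rw [affineMap_last]
  | cast i => exact h i

theorem affineMap_one_zero (i : Fin 14) : affineMap 1 0 i = i := by
  revert i
  decide

/-- The coordinate permutation `x ↦ a * x + t` fixing the last coordinate. -/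
def affinePerm (a : (ZMod 13)ˣ) (t : ZMod 13) : Equiv.Perm (Fin 14) where
  toFun := affineMap a t
  invFun := affineMap ↑a⁻¹ (-(↑a⁻¹ * t))
  left_inv i := by
    rw [affineMap_affineMap, Units.inv_mul, add_neg_cancel, affineMap_one_zero]
  right_inv i := by
    rw [affineMap_affineMap, Units.mul_inv, mul_neg, Units.mul_inv_cancel_left, neg_add_cancel,
      affineMap_one_zero]

theorem affinePerm_residuePoint (a : (ZMod 13)ˣ) (t x : ZMod 13) :
    affinePerm a t (residuePoint x) = residuePoint (a * x + t) :=
  affineMap_residuePoint ..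

theorem affinePerm_last (a : (ZMod 13)ˣ) (t : ZMod 13) :
    affinePerm a t (Fin.last 13) = Fin.last 13 :=
  affineMap_last (a : ZMod 13) t

/-- The translate by `t` of a quadratic class modulo 13, as a set of coordinates. -/
def classTranslate (b : Bool) (t : ZMod 13) : Finset (Fin 14) :=
  (quadClass b).image fun d => residuePoint (t + d)

theorem classTranslate_injective (b : Bool) : Function.Injective (classTranslate b) := by
  have h : ∀ b t t', classTranslate b t = classTranslate b t' → t = t' := by decide +kernel
  exact h b

theorem card_classTranslate (b : Bool) (t : ZMod 13) : (classTranslate b t).card = 6 := by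
  revert b t
  decide +kernel

theorem three_dvd_card_classTranslate (b : Bool) (t j : ZMod 13) :
    3 ∣ ((quadClass b).filter fun d => residuePoint (j + d) ∈ classTranslate (!b) t).card := by
  revert b t j
  decide +kernel

/-- The `{0, 1}`-words of weight 6 satisfying six of the parity checks. -/
theorem bool_word_eq_classTranslate : ∀ x0 x1 x2 x3 x4 x5 x6 x7 x8 x9 x10 x11 x12 y : Bool,
    x0.toNat + x1.toNat + x2.toNat + x3.toNat + x4.toNat + x5.toNat + x6.toNat + x7.toNat +
      x8.toNat + x9.toNat + x10.toNat + x11.toNat + x12.toNat + y.toNat = 6 →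
    3 ∣ x1.toNat + x3.toNat + x4.toNat + x9.toNat + x10.toNat + x12.toNat →
    3 ∣ x2.toNat + x4.toNat + x5.toNat + x10.toNat + x11.toNat + x0.toNat →
    3 ∣ x3.toNat + x5.toNat + x6.toNat + x11.toNat + x12.toNat + x1.toNat →
    3 ∣ x4.toNat + x6.toNat + x7.toNat + x12.toNat + x0.toNat + x2.toNat →
    3 ∣ x5.toNat + x7.toNat + x8.toNat + x0.toNat + x1.toNat + x3.toNat →
    3 ∣ x6.toNat + x8.toNat + x9.toNat + x1.toNat + x2.toNat + x4.toNat →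
    ∃ t, ∀ i, ![x0, x1, x2, x3, x4, x5, x6, x7, x8, x9, x10, x11, x12, y] i =
      decide (i ∈ classTranslate false t) := by
  decide +kernel

theorem sum_quadClass_true (f : ZMod 13 → ℕ) :
    ∑ d ∈ quadClass true, f d = f 1 + f 3 + f 4 + f 9 + f 10 + f 12 := by
  simp +decide [quadClass, Finset.sum_insert, add_assoc]

theorem exists_eq_classTranslate_false {S : Finset (Fin 14)} (hS : S.card = 6)
    (h : ∀ j, 3 ∣ ((quadClass true).filter fun d => residuePoint (j + d) ∈ S).card) :
    ∃ t, S = classTranslate false t := by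
  let p : Fin 14 → Bool := fun i => decide (i ∈ S)
  have hp (i : Fin 14) : (p i).toNat = if i ∈ S then 1 else 0 := by
    by_cases hi : i ∈ S <;> simp [p, hi]
  have hw : ∑ i, (p i).toNat = 6 := by
    simp_rw [hp]
    simpa using hS
  simp_rw [Finset.card_filter, ← hp, sum_quadClass_true] at h
  simp only [Fin.sum_univ_succ, Finset.univ_eq_empty, Finset.sum_empty, add_zero,
    ← add_assoc] at hw
  obtain ⟨t, ht⟩ := bool_word_eq_classTranslate (p 0) (p 1) (p 2) (p 3) (p 4) (p 5) (p 6) (p 7)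
    (p 8) (p 9) (p 10) (p 11) (p 12) (p 13) hw (h 0) (h 1) (h 2) (h 3) (h 4) (h 5)
  refine ⟨t, Finset.ext fun i => ?_⟩
  rw [← decide_eq_decide, ← ht]
  change p i = _
  fin_cases i <;> rfl

theorem exists_eq_classTranslate {b : Bool} {S : Finset (Fin 14)} (hS : S.card = 6)
    (h : ∀ j, 3 ∣ ((quadClass b).filter fun d => residuePoint (j + d) ∈ S).card) :
    ∃ t, S = classTranslate (!b) t := by
  obtain ⟨a, ha⟩ : ∃ a : (ZMod 13)ˣ, ∀ b',
      (quadClass b').image ((a : ZMod 13) * ·) = quadClass (b' == b) := by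
    cases b
    · exact ⟨⟨2, 7, rfl, rfl⟩, by decide +kernel⟩
    · exact ⟨1, by decide +kernel⟩
  set σ := affinePerm a 0
  have hσ (x : ZMod 13) : σ (residuePoint x) = residuePoint (a * x) := by
    rw [affinePerm_residuePoint, add_zero]
  obtain ⟨t, ht⟩ := exists_eq_classTranslate_false (S := S.image σ.symm)
    (by rw [Finset.card_image_of_injective _ σ.symm.injective, hS]) fun j => by
      have hmem (x : ZMod 13) : residuePoint x ∈ S.image σ.symm ↔ residuePoint (a * x) ∈ S := by
        rw [← hσ]
        simp [Equiv.symm_apply_eq]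
      have hj := h (a * j)
      rw [show quadClass b = (quadClass true).image ((a : ZMod 13) * ·) by rw [ha]; simp,
        Finset.filter_image, Finset.card_image_of_injective _ a.isUnit.mul_right_injective] at hj
      simpa only [hmem, mul_add] using hj
  refine ⟨a * t, ?_⟩
  have hS' : S = (classTranslate false t).image σ := by
    rw [← ht]
    simp [Finset.image_image]
  rw [hS', classTranslate, classTranslate,
    show quadClass (!b) = (quadClass false).image ((a : ZMod 13) * ·) by rw [ha]; simp,
    Finset.image_image, Finset.image_image]
  refine Finset.image_congr fun d _ => ?_
  simp only [Function.comp_apply, hσ, mul_add]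

theorem sextets_parityCheck (b : Bool) :
    sextets (ParityCheck b) = Finset.univ.map ⟨classTranslate (!b), classTranslate_injective _⟩ := by
  ext S
  simp only [sextets, Finset.mem_filter, Finset.mem_powersetCard_univ, Finset.mem_map,
    Finset.mem_univ, true_and, Function.Embedding.coeFn_mk]
  constructor
  · rintro ⟨hS, h⟩
    obtain ⟨t, ht⟩ := exists_eq_classTranslate hS fun j => by
      have hj := h.1 j
      rwa [Finset.sum_boole, ZMod.natCast_eq_zero_iff] at hj
    exact ⟨t, ht.symm⟩
  · rintro ⟨t, rfl⟩
    refine ⟨card_classTranslate _ t, fun j => ?_, ?_⟩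
    · rw [Finset.sum_boole, ZMod.natCast_eq_zero_iff]
      exact three_dvd_card_classTranslate b t j
    · have hsum : ∑ i : Fin 14, (if i ∈ classTranslate (!b) t then (1 : ZMod 3) else 0) = 0 := by
        rw [Finset.sum_boole, Finset.filter_mem_eq_inter, Finset.univ_inter, card_classTranslate]
        rfl
      rw [Fin.sum_univ_castSucc] at hsum
      exact eq_neg_of_add_eq_zero_right hsum

theorem affinePerm_mem_stableMonoid {a : (ZMod 13)ˣ} (ha : (a : ZMod 13) ∈ quadClass true)
    (t : ZMod 13) (b : Bool) : affinePerm a t ∈ stableMonoid (ParityCheck b) := by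
  intro c hc
  refine ⟨fun j => ?_, ?_⟩
  · have h := hc.1 (a * j + t)
    rw [← image_mul_quadClass a ha b,
      Finset.sum_image (mul_left_injective_of_mem_quadClass ha).injOn] at h
    rw [← h]
    refine Finset.sum_congr rfl fun d _ => ?_
    rw [Function.comp_apply, affinePerm_residuePoint]
    congr 2
    ring
  · rw [Function.comp_apply, affinePerm_last, hc.2, neg_inj]
    symm
    refine Fintype.sum_equiv
      ((Units.mulLeft a).trans (Equiv.addRight t) : Equiv.Perm (ZMod 13)) _ _ fun i => ?_
    exact congrArg c (affinePerm_residuePoint a t i)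

/-- Representatives of the orbits on triples. -/
def tripleReps : Finset (Finset (Fin 14)) :=
  {{0, 1, 2}, {0, 1, 3}, {0, 1, 4}, {0, 1, 6}, {0, 1, 7}, {0, 2, 7}, {0, 1, 13}, {0, 2, 13}}

theorem card_tripleReps : tripleReps.card = 8 := by
  decide +kernel

theorem card_of_mem_tripleReps : ∀ T ∈ tripleReps, T.card = 3 := by
  intro T hT
  simp only [tripleReps, Finset.mem_insert, Finset.mem_singleton] at hT
  rcases hT with rfl | rfl | rfl | rfl | rfl | rfl | rfl | rfl <;> rfl

theorem exists_affineMap_mem_tripleReps : ∀ k, ∀ j < k, 0 < j → ∃ a ∈ quadClass true, ∃ t,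
    ∃ T ∈ tripleReps, affineMap a t 0 ∈ T ∧ affineMap a t j ∈ T ∧ affineMap a t k ∈ T := by
  decide +kernel

theorem intersectionType_injOn_tripleReps (b : Bool) :
    Set.InjOn (fun T => intersectionType (sextets (ParityCheck b)) T)
      (tripleReps : Set (Finset (Fin 14))) := by
  have h : ∀ b, ∀ s ∈ [(2, 0), (1, 1), (1, 0), (2, 1), (1, 2), (3, 0), (3, 1), (4, 0)],
      ∃ T ∈ tripleReps,
        (Finset.univ.filter fun x => T ∩ classTranslate b x = ∅).card = s.1 ∧
          (Finset.univ.filter fun x => T ⊆ classTranslate b x).card = s.2 := by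
    decide +kernel
  refine Finset.injOn_of_card_image_eq (le_antisymm Finset.card_image_le ?_)
  rw [card_tripleReps]
  change ({(2, 0), (1, 1), (1, 0), (2, 1), (1, 2), (3, 0), (3, 1), (4, 0)} :
    Finset (ℕ × ℕ)).card ≤ _
  refine Finset.card_le_card fun s hs => ?_
  obtain ⟨T, hT, h₁, h₂⟩ := h (!b) s (by simpa using hs)
  refine Finset.mem_image.2 ⟨T, hT, ?_⟩
  rw [intersectionType, sextets_parityCheck, Finset.filter_map, Finset.filter_map,
    Finset.card_map, Finset.card_map]
  exact Prod.ext h₁ h₂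

theorem exists_stableOrbit_eq_of_zero_mem (b : Bool) {T : Finset (Fin 14)} (hT : T.card = 3)
    (h0 : 0 ∈ T) :
    ∃ T₀ ∈ tripleReps, stableOrbit (ParityCheck b) T₀ = stableOrbit (ParityCheck b) T := by
  have : Fact (Nat.Prime 13) := ⟨by norm_num⟩
  obtain ⟨j, k, hj, hjk, rfl⟩ : ∃ j k, 0 < j ∧ j < k ∧ T = {0, j, k} := by
    obtain ⟨j, k, hne, hjk⟩ := Finset.card_eq_two.1
      (show (T.erase 0).card = 2 by rw [Finset.card_erase_of_mem h0, hT])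
    have hj : 0 < j := Fin.pos_of_ne_zero
      (Finset.ne_of_mem_erase (show j ∈ T.erase 0 by simp [hjk]))
    have hk : 0 < k := Fin.pos_of_ne_zero
      (Finset.ne_of_mem_erase (show k ∈ T.erase 0 by simp [hjk]))
    have hT' : T = {0, j, k} := by rw [← hjk, Finset.insert_erase h0]
    rcases hne.lt_or_gt with h | h
    · exact ⟨j, k, hj, h, hT'⟩
    · exact ⟨k, j, hk, h, by rw [hT', Finset.pair_comm]⟩
  obtain ⟨a, ha, t, T₀, hT₀, h₀, h₁, h₂⟩ := exists_affineMap_mem_tripleReps k j hjk hj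
  have ha0 : a ≠ 0 := ((ne_zero_and_isSquare_iff a).2 ha).1
  refine ⟨T₀, hT₀, ?_⟩
  rw [← stableOrbit_image (affinePerm_mem_stableMonoid (a := Units.mk0 a ha0) ha t b)
    {0, j, k}]
  congr 1
  symm
  refine Finset.eq_of_subset_of_card_le ?_ ?_
  · simp only [Finset.image_insert, Finset.image_singleton, Finset.insert_subset_iff,
      Finset.singleton_subset_iff]
    exact ⟨h₀, h₁, h₂⟩
  · rw [Finset.card_image_of_injective _ (Equiv.injective _), hT, card_of_mem_tripleReps _ hT₀]

theorem exists_stableOrbit_eq (b : Bool) {T : Finset (Fin 14)} (hT : T.card = 3) :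
    ∃ T₀ ∈ tripleReps, stableOrbit (ParityCheck b) T₀ = stableOrbit (ParityCheck b) T := by
  obtain ⟨i, hi, hne⟩ : ∃ i ∈ T, i ≠ Fin.last 13 :=
    Finset.exists_mem_ne (by omega) _
  obtain ⟨x, rfl⟩ : ∃ x : ZMod 13, residuePoint x = i := Fin.exists_castSucc_eq.2 hne
  rw [← stableOrbit_image (affinePerm_mem_stableMonoid (a := 1) (by decide) (-x) b) T]
  refine exists_stableOrbit_eq_of_zero_mem b ?_ (Finset.mem_image.2 ⟨_, hi, ?_⟩)
  · rw [Finset.card_image_of_injective _ (Equiv.injective _), hT]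
  · rw [affinePerm_residuePoint, Units.val_one, one_mul, add_neg_cancel]
    rfl

theorem stableOrbit_injOn_tripleReps (b : Bool) :
    Set.InjOn (stableOrbit (ParityCheck b)) (tripleReps : Set (Finset (Fin 14))) := by
  intro T hT T' hT' h
  obtain ⟨σ, hσ, rfl⟩ : T' ∈ stableOrbit (ParityCheck b) T := h ▸ mem_stableOrbit_self _ T'
  exact intersectionType_injOn_tripleReps b hT hT' (intersectionType_image hσ T).symm

/-- The automorphism group of the extended ternary quadratic residue code `C` of length 14
(all coordinate permutations sending codewords to codewords) acts on the 3-element subsets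
of `{1, …, 14}` with exactly 8 orbits. -/
theorem ternary_aut_orbits_on_triples (K : Type) [Field K] [Algebra (ZMod 3) K] (α : K)
    (hα : IsPrimitiveRoot α 13) :
    {O : Set (Finset (Fin 14)) | ∃ T : Finset (Fin 14), T.card = 3 ∧
      O = {T' | ∃ σ : Equiv.Perm (Fin 14),
        (∀ c : Fin 14 → ZMod 3, extQR3Mem α c → extQR3Mem α (c ∘ σ)) ∧
        T.image σ = T'}}.ncard = 8 := by
  obtain ⟨b, hb⟩ := exists_extQR3Mem_iff_parityCheck hα
  calc
    _ = (stableOrbit (ParityCheck b) '' (tripleReps : Set (Finset (Fin 14)))).ncard := by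
      congr 1
      ext O
      simp only [hb]
      constructor
      · rintro ⟨T, hT, rfl⟩
        exact exists_stableOrbit_eq b hT
      · rintro ⟨T, hT, rfl⟩
        exact ⟨T, card_of_mem_tripleReps T hT, rfl⟩
    _ = 8 := by
      rw [(stableOrbit_injOn_tripleReps b).ncard_image, Set.ncard_coe_finset, card_tripleReps]
end
end

section
/- Let C be the extended quaternary quadratic residue code of length 18 and let Aut(C) = {σ ∈ S_18 : permuting the coordinates of every codeword of C by σ again yields a codeword of C}. Then the induced action of Aut(C) on the set of 3-element subsets of {1,…,18} has exactly 2 orbits. -/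
open scoped Classical

noncomputable section

section Triples

/-- The submonoid of coordinate permutations preserving a set `P` of words. -/
def preserving (P : (Fin 18 → F4) → Prop) : Submonoid (Equiv.Perm (Fin 18)) where
  carrier := {σ | ∀ c, P c → P (c ∘ σ)}
  one_mem' _ hc := hc
  mul_mem' hσ hτ c hc := hτ _ (hσ c hc)

lemma inv_mem_preserving {P : (Fin 18 → F4) → Prop} {σ : Equiv.Perm (Fin 18)}
    (hσ : σ ∈ preserving P) : σ⁻¹ ∈ preserving P := by
  have h : σ⁻¹ = σ ^ (orderOf σ - 1) := by
    refine inv_eq_of_mul_eq_one_left ?_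
    rw [← pow_succ, Nat.sub_add_cancel (orderOf_pos σ), pow_orderOf_eq_one]
  exact h ▸ pow_mem hσ _

/-- The orbit of a set of coordinates under the permutations preserving `P`. -/
def orbitOf (P : (Fin 18 → F4) → Prop) (T : Finset (Fin 18)) : Set (Finset (Fin 18)) :=
  {T' | ∃ σ : Equiv.Perm (Fin 18), (∀ c, P c → P (c ∘ σ)) ∧ T.image σ = T'}

lemma self_mem_orbitOf (P : (Fin 18 → F4) → Prop) (T : Finset (Fin 18)) : T ∈ orbitOf P T :=
  ⟨1, fun _ hc => hc, by simp⟩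

lemma orbitOf_image {P : (Fin 18 → F4) → Prop} {σ : Equiv.Perm (Fin 18)}
    (hσ : σ ∈ preserving P) (T : Finset (Fin 18)) : orbitOf P (T.image σ) = orbitOf P T := by
  ext T'
  constructor
  · rintro ⟨τ, hτ, rfl⟩
    exact ⟨τ * σ, (preserving P).mul_mem hτ hσ, by simp [Finset.image_image]⟩
  · rintro ⟨τ, hτ, rfl⟩
    exact ⟨τ * σ⁻¹, (preserving P).mul_mem hτ (inv_mem_preserving hσ), by
      rw [Finset.image_image]; congr 1; ext i; simp⟩

/-- The supports of weight 6 words with entries in `{0, 1}` satisfying `P` that contain `T`. -/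
def hexads (P : (Fin 18 → F4) → Prop) (T : Finset (Fin 18)) : Finset (Finset (Fin 18)) :=
  Finset.univ.filter fun S => P (fun i => if i ∈ S then 1 else 0) ∧ S.card = 6 ∧ T ⊆ S

lemma card_hexads_image_le {P : (Fin 18 → F4) → Prop} {σ : Equiv.Perm (Fin 18)}
    (hσ : σ ∈ preserving P) (T : Finset (Fin 18)) :
    (hexads P (T.image σ)).card ≤ (hexads P T).card := by
  refine Finset.card_le_card_of_injOn (fun S => S.image (σ⁻¹ : Equiv.Perm (Fin 18))) ?_
    (Finset.image_injective σ⁻¹.injective).injOn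
  intro S hS
  simp only [hexads, Finset.coe_filter, Finset.mem_univ, true_and, Set.mem_ofPred_eq] at hS ⊢
  obtain ⟨hP, hcard, hT⟩ := hS
  refine ⟨?_, by rw [Finset.card_image_of_injective _ σ⁻¹.injective, hcard], ?_⟩
  · convert hσ _ hP using 2 with i
    simp [Equiv.symm_apply_eq]
  · intro i hi
    exact Finset.mem_image.2 ⟨σ i, hT (Finset.mem_image_of_mem _ hi), by simp⟩

/-- The map `x ↦ x + 1` of the projective line over `ZMod 17`, with `17` the point at infinity. -/
def translation : Equiv.Perm (Fin 18) where
  toFun := ![1, 2, 3, 4, 5, 6, 7, 8, 9, 10, 11, 12, 13, 14, 15, 16, 0, 17]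
  invFun := ![16, 0, 1, 2, 3, 4, 5, 6, 7, 8, 9, 10, 11, 12, 13, 14, 15, 17]
  left_inv := by decide
  right_inv := by decide

/-- The map `x ↦ 2 * x` of the projective line over `ZMod 17`. -/
def doubling : Equiv.Perm (Fin 18) where
  toFun := ![0, 2, 4, 6, 8, 10, 12, 14, 16, 1, 3, 5, 7, 9, 11, 13, 15, 17]
  invFun := ![0, 9, 1, 10, 2, 11, 3, 12, 4, 13, 5, 14, 6, 15, 7, 16, 8, 17]
  left_inv := by decide
  right_inv := by decide

/-- The map `x ↦ -1 / x` of the projective line over `ZMod 17`. -/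
def inversion : Equiv.Perm (Fin 18) where
  toFun := ![17, 16, 8, 11, 4, 10, 14, 12, 2, 15, 5, 3, 7, 13, 6, 9, 1, 0]
  invFun := ![17, 16, 8, 11, 4, 10, 14, 12, 2, 15, 5, 3, 7, 13, 6, 9, 1, 0]
  left_inv := by decide
  right_inv := by decide

lemma translation_pow_last (n : ℕ) : (translation ^ n) 17 = 17 :=
  Equiv.Perm.pow_apply_eq_self_of_apply_eq_self (by decide) n

lemma doubling_pow_last (n : ℕ) : (doubling ^ n) 17 = 17 :=
  Equiv.Perm.pow_apply_eq_self_of_apply_eq_self (by decide) n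

lemma doubling_pow_zero (n : ℕ) : (doubling ^ n) 0 = 0 :=
  Equiv.Perm.pow_apply_eq_self_of_apply_eq_self (by decide) n

lemma exists_translation_pow : ∀ a : Fin 18, a ≠ 17 → ∃ n : Fin 17, (translation ^ n.val) a = 0 := by
  decide +kernel

lemma exists_doubling_pow : ∀ a : Fin 18, a ≠ 17 → a ≠ 0 →
    ∃ n : Fin 8, (doubling ^ n.val) a = 1 ∨ (doubling ^ n.val) a = 3 := by
  decide +kernel

/-- Every triple can be moved to `{∞, 0, 1}` or `{∞, 0, 3}` by translations, doubling and
inversion. -/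
lemma exists_image_eq (G : Submonoid (Equiv.Perm (Fin 18))) (ht : translation ∈ G)
    (hd : doubling ∈ G) (hi : inversion ∈ G) {T : Finset (Fin 18)} (hT : T.card = 3) :
    ∃ σ ∈ G, T.image σ = {17, 0, 1} ∨ T.image σ = {17, 0, 3} := by
  obtain ⟨a, b, c, hab, hac, hbc, rfl⟩ := Finset.card_eq_three.1 hT
  obtain ⟨σ, hσ, hσa⟩ : ∃ σ ∈ G, σ a = 17 := by
    by_cases ha : a = 17
    · exact ⟨1, G.one_mem, ha⟩
    · obtain ⟨n, hn⟩ := exists_translation_pow a ha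
      exact ⟨inversion * translation ^ n.val, G.mul_mem hi (G.pow_mem ht _), by
        rw [Equiv.Perm.mul_apply, hn]; decide⟩
  obtain ⟨n, hn⟩ := exists_translation_pow (σ b) fun h => hab (σ.injective (hσa.trans h.symm))
  set τ := translation ^ n.val * σ with hτ
  have hτa : τ a = 17 := by rw [hτ, Equiv.Perm.mul_apply, hσa, translation_pow_last]
  have hτb : τ b = 0 := hn
  obtain ⟨k, hk⟩ := exists_doubling_pow (τ c) (fun h => hac (τ.injective (hτa.trans h.symm)))
    (fun h => hbc (τ.injective (hτb.trans h.symm)))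
  refine ⟨doubling ^ k.val * τ,
    G.mul_mem (G.pow_mem hd _) (G.mul_mem (G.pow_mem ht _) hσ), ?_⟩
  simp only [Finset.image_insert, Finset.image_singleton, Equiv.Perm.mul_apply, hτa, hτb,
    doubling_pow_last, doubling_pow_zero]
  exact hk.imp (fun h => by rw [h]) (fun h => by rw [h])

lemma ncard_orbits_eq_two {P : (Fin 18 → F4) → Prop} (ht : translation ∈ preserving P)
    (hd : doubling ∈ preserving P) (hi : inversion ∈ preserving P)
    (hne : (hexads P {17, 0, 1}).card ≠ (hexads P {17, 0, 3}).card) :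
    {O | ∃ T : Finset (Fin 18), T.card = 3 ∧ O = orbitOf P T}.ncard = 2 := by
  refine Set.ncard_eq_two.2 ⟨orbitOf P {17, 0, 1}, orbitOf P {17, 0, 3}, fun h => ?_, ?_⟩
  · obtain ⟨σ, hσ, h₁⟩ := h ▸ self_mem_orbitOf P {17, 0, 1}
    obtain ⟨τ, hτ, h₂⟩ := h.symm ▸ self_mem_orbitOf P {17, 0, 3}
    exact hne (le_antisymm (h₁ ▸ card_hexads_image_le hσ _) (h₂ ▸ card_hexads_image_le hτ _))
  · ext O
    constructor
    · rintro ⟨T, hT, rfl⟩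
      obtain ⟨σ, hσ, h⟩ := exists_image_eq _ ht hd hi hT
      rw [← orbitOf_image hσ T]
      exact h.imp (congrArg _) (congrArg _)
    · rintro (rfl | rfl)
      · exact ⟨_, by decide, rfl⟩
      · exact ⟨_, by decide, rfl⟩

end Triples

section ParityCheck

/-- The word `c` is annihilated by the binary matrix `H`. -/
def InKernel (H : Fin 9 → Fin 18 → ZMod 2) (c : Fin 18 → F4) : Prop :=
  ∀ r, ∑ i, algebraMap (ZMod 2) F4 (H r i) * c i = 0

lemma mem_preserving_inKernel {H : Fin 9 → Fin 18 → ZMod 2} {σ : Equiv.Perm (Fin 18)}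
    (A : Fin 9 → Fin 9 → ZMod 2) (hA : ∀ r i, H r i = ∑ k, A r k * H k (σ i)) :
    σ ∈ preserving (InKernel H) := by
  intro c hc r
  calc ∑ i, algebraMap (ZMod 2) F4 (H r i) * c (σ i)
      = ∑ i, ∑ k, algebraMap (ZMod 2) F4 (A r k) *
          (algebraMap (ZMod 2) F4 (H k (σ i)) * c (σ i)) := by
        refine Finset.sum_congr rfl fun i _ => ?_
        rw [hA r i, map_sum, Finset.sum_mul]
        simp only [map_mul, mul_assoc]
    _ = ∑ k, algebraMap (ZMod 2) F4 (A r k) *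
          ∑ i, algebraMap (ZMod 2) F4 (H k (σ i)) * c (σ i) := by
        rw [Finset.sum_comm]
        simp only [Finset.mul_sum]
    _ = 0 := by
        refine Finset.sum_eq_zero fun k _ => ?_
        rw [Equiv.sum_comp σ (fun j => algebraMap (ZMod 2) F4 (H k j) * c j), hc k, mul_zero]

lemma inKernel_indicator (H : Fin 9 → Fin 18 → ZMod 2) (S : Finset (Fin 18)) :
    InKernel H (fun i => if i ∈ S then 1 else 0) ↔ ∀ r, ∑ i ∈ S, H r i = 0 := by
  refine forall_congr' fun r => ?_
  simp only [mul_ite, mul_one, mul_zero, Finset.sum_ite_mem, Finset.univ_inter, ← map_sum]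
  exact map_eq_zero_iff _ (algebraMap (ZMod 2) F4).injective

lemma mem_hexads_inKernel {H : Fin 9 → Fin 18 → ZMod 2} {S T : Finset (Fin 18)} :
    S ∈ hexads (InKernel H) T ↔ (∀ r, ∑ i ∈ S, H r i = 0) ∧ S.card = 6 ∧ T ⊆ S := by
  rw [hexads, Finset.mem_filter, inKernel_indicator]
  simp

/-- The `r`-th binary digit of `n`. -/
def binaryDigit (r n : ℕ) : ZMod 2 := if n.testBit r then 1 else 0

lemma binaryDigit_zero (r : ℕ) : binaryDigit r 0 = 0 := by simp [binaryDigit]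

lemma binaryDigit_xor (r m n : ℕ) :
    binaryDigit r (m ^^^ n) = binaryDigit r m + binaryDigit r n := by
  simp only [binaryDigit, Nat.testBit_xor]
  cases m.testBit r <;> cases n.testBit r <;> decide

lemma binaryDigit_foldr_xor {ι : Type} (r : ℕ) (l : List ι) (f : ι → ℕ) :
    binaryDigit r (l.foldr (fun i x => f i ^^^ x) 0) = (l.map fun i => binaryDigit r (f i)).sum := by
  induction l with
  | nil => exact binaryDigit_zero r
  | cons i l ih => rw [List.foldr_cons, binaryDigit_xor, ih, List.map_cons, List.sum_cons]

lemma forall_binaryDigit_eq_zero_iff (n : ℕ) :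
    (∀ r : Fin 9, binaryDigit r n = 0) ↔ n % 512 = 0 := by
  simp only [binaryDigit, ite_eq_right_iff, one_ne_zero, imp_false, Bool.not_eq_true]
  rw [show 512 = 2 ^ 9 by rfl]
  constructor
  · intro h
    refine Nat.eq_of_testBit_eq fun r => ?_
    rw [Nat.testBit_mod_two_pow, Nat.zero_testBit]
    by_cases hr : r < 9
    · simp [h ⟨r, hr⟩]
    · simp [hr]
  · intro h r
    have hr : (n % 2 ^ 9).testBit r = false := by rw [h, Nat.zero_testBit]
    rwa [Nat.testBit_mod_two_pow, decide_eq_true r.isLt, Bool.true_and] at hr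

/-- The binary matrix whose `i`-th column has the binary digits of `s i` as its entries. -/
def bitMatrix (s : Fin 18 → ℕ) (r : Fin 9) (i : Fin 18) : ZMod 2 := binaryDigit r (s i)

/-- The image of the binary vector encoded by `n` under the linear map sending the `k`-th unit
vector to the vector encoded by `a k`. -/
def xorApply (a : Fin 9 → ℕ) (n : ℕ) : ℕ :=
  (List.finRange 9).foldr (fun k x => (if n.testBit k.val then a k else 0) ^^^ x) 0

lemma binaryDigit_xorApply (r : ℕ) (a : Fin 9 → ℕ) (n : ℕ) :
    binaryDigit r (xorApply a n) = ∑ k : Fin 9, binaryDigit r (a k) * binaryDigit k n := by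
  rw [xorApply, binaryDigit_foldr_xor, ← List.ofFn_eq_map, List.sum_ofFn]
  refine Finset.sum_congr rfl fun k _ => ?_
  conv_rhs => rw [binaryDigit.eq_def k]
  split_ifs <;> simp [binaryDigit_zero]

/-- If columns `k` and `17` of `bitMatrix s` sum to the `k`-th unit vector for `k < 8` and column
`17` is the last unit vector, this describes the only linear map that could take column `σ i` to
column `i` for all `i`. -/
def columnAction (s : Fin 18 → ℕ) (σ : Equiv.Perm (Fin 18)) (k : Fin 9) : ℕ :=
  s (σ.symm 17) ^^^ if k = 8 then 0 else s (σ.symm (k.castLE (by decide)))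

lemma mem_preserving_bitMatrix {s : Fin 18 → ℕ} {σ : Equiv.Perm (Fin 18)}
    (h : ∀ i, xorApply (columnAction s σ) (s (σ i)) = s i) :
    σ ∈ preserving (InKernel (bitMatrix s)) :=
  mem_preserving_inKernel (fun r k => binaryDigit r (columnAction s σ k)) fun r i => by
    simp only [bitMatrix]
    rw [← binaryDigit_xorApply, h]

/-- The sum of the columns `s i` for `i` in a list. -/
def columnSum (s : Fin 18 → ℕ) (l : List (Fin 18)) : ℕ := l.foldr (fun i x => s i ^^^ x) 0

lemma toFinset_mem_hexads_iff {s : Fin 18 → ℕ} {T : Finset (Fin 18)} {l : List (Fin 18)}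
    (hl : l.Nodup) : l.toFinset ∈ hexads (InKernel (bitMatrix s)) T ↔
      columnSum s l % 512 = 0 ∧ l.length = 6 ∧ T ⊆ l.toFinset := by
  rw [mem_hexads_inKernel, List.toFinset_card_of_nodup hl, ← forall_binaryDigit_eq_zero_iff]
  simp only [columnSum, binaryDigit_foldr_xor, List.sum_toFinset _ hl, bitMatrix]

/-- The hexads through a triple, as a finite check on the complementary triples. -/
lemma hexads_subset {s : Fin 18 → ℕ} {x : Fin 18} {L : Finset (Finset (Fin 18))}
    (hx : [17, 0, x].Nodup)
    (h : ∀ d e f, columnSum s [17, 0, x, d, e, f] % 512 = 0 → [17, 0, x, d, e, f].Nodup →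
      [17, 0, x, d, e, f].toFinset ∈ L) :
    hexads (InKernel (bitMatrix s)) {17, 0, x} ⊆ L := by
  intro S hS
  obtain ⟨-, hcard, hT⟩ := mem_hexads_inKernel.1 hS
  have hdiff : (S \ {17, 0, x}).card = 3 := by
    rw [Finset.card_sdiff_of_subset hT, hcard]
    have h3 := List.toFinset_card_of_nodup hx
    simp only [List.toFinset_cons, List.toFinset_nil, insert_empty_eq] at h3
    rw [h3]
    rfl
  obtain ⟨d, e, f, -, -, -, hS'⟩ := Finset.card_eq_three.1 hdiff
  have hl : S = [17, 0, x, d, e, f].toFinset := by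
    rw [← Finset.union_sdiff_of_subset hT, hS']
    ext i
    simp only [Finset.mem_union, Finset.mem_insert, Finset.mem_singleton, List.mem_toFinset,
      List.mem_cons, List.not_mem_nil]
    tauto
  have hnodup : [17, 0, x, d, e, f].Nodup := by
    rw [← Multiset.coe_nodup, ← Multiset.toFinset_card_eq_card_iff_nodup, List.toFinset_coe, ← hl,
      hcard]
    rfl
  rw [hl] at hS ⊢
  exact h d e f ((toFinset_mem_hexads_iff hnodup).1 hS).1 hnodup

end ParityCheck
section QuadraticResidueCode

/-- Column `i < 17` encodes `X ^ i` modulo `X ^ 8 + X ^ 5 + X ^ 4 + X ^ 3 + 1`, preceded by a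
parity bit. -/
def residueColumns : Fin 18 → ℕ :=
  ![257, 258, 260, 264, 272, 288, 320, 384, 313, 370, 484, 497, 475, 399, 295, 334, 412, 256]

/-- Column `i < 17` encodes `X ^ i` modulo `X ^ 8 + X ^ 7 + X ^ 6 + X ^ 4 + X ^ 2 + X + 1`,
preceded by a parity bit. -/
def nonresidueColumns : Fin 18 → ℕ :=
  ![257, 258, 260, 264, 272, 288, 320, 384, 471, 377, 498, 307, 358, 460, 335, 414, 491, 256]

lemma translation_mem_preserving_residue :
    translation ∈ preserving (InKernel (bitMatrix residueColumns)) :=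
  mem_preserving_bitMatrix (by decide +kernel)

lemma doubling_mem_preserving_residue :
    doubling ∈ preserving (InKernel (bitMatrix residueColumns)) :=
  mem_preserving_bitMatrix (by decide +kernel)

lemma inversion_mem_preserving_residue :
    inversion ∈ preserving (InKernel (bitMatrix residueColumns)) :=
  mem_preserving_bitMatrix (by decide +kernel)

lemma card_hexads_residue :
    (hexads (InKernel (bitMatrix residueColumns)) {17, 0, 3}).card <
      (hexads (InKernel (bitMatrix residueColumns)) {17, 0, 1}).card := by
  have hle : hexads (InKernel (bitMatrix residueColumns)) {17, 0, 3} ⊆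
      {[17, 0, 3, 4, 5, 8].toFinset, [17, 0, 3, 12, 15, 16].toFinset} :=
    hexads_subset (by decide) (by decide +kernel)
  have hge : {[17, 0, 1, 2, 5, 14].toFinset, [17, 0, 1, 4, 13, 16].toFinset,
      [17, 0, 1, 7, 9, 11].toFinset} ⊆
      hexads (InKernel (bitMatrix residueColumns)) {17, 0, 1} := by
    intro S hS
    simp only [Finset.mem_insert, Finset.mem_singleton] at hS
    rcases hS with rfl | rfl | rfl <;>
      exact (toFinset_mem_hexads_iff (by decide)).2 (by decide +kernel)
  exact (Finset.card_le_card hle).trans_lt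
    (lt_of_lt_of_le (by decide +kernel) (Finset.card_le_card hge))

lemma translation_mem_preserving_nonresidue :
    translation ∈ preserving (InKernel (bitMatrix nonresidueColumns)) :=
  mem_preserving_bitMatrix (by decide +kernel)

lemma doubling_mem_preserving_nonresidue :
    doubling ∈ preserving (InKernel (bitMatrix nonresidueColumns)) :=
  mem_preserving_bitMatrix (by decide +kernel)

lemma inversion_mem_preserving_nonresidue :
    inversion ∈ preserving (InKernel (bitMatrix nonresidueColumns)) :=
  mem_preserving_bitMatrix (by decide +kernel)

lemma card_hexads_nonresidue :
    (hexads (InKernel (bitMatrix nonresidueColumns)) {17, 0, 1}).card <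
      (hexads (InKernel (bitMatrix nonresidueColumns)) {17, 0, 3}).card := by
  have hle : hexads (InKernel (bitMatrix nonresidueColumns)) {17, 0, 1} ⊆
      {[17, 0, 1, 4, 5, 11].toFinset, [17, 0, 1, 7, 13, 14].toFinset} :=
    hexads_subset (by decide) (by decide +kernel)
  have hge : {[17, 0, 3, 4, 10, 16].toFinset, [17, 0, 3, 5, 12, 14].toFinset,
      [17, 0, 3, 6, 8, 15].toFinset} ⊆
      hexads (InKernel (bitMatrix nonresidueColumns)) {17, 0, 3} := by
    intro S hS
    simp only [Finset.mem_insert, Finset.mem_singleton] at hS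
    rcases hS with rfl | rfl | rfl <;>
      exact (toFinset_mem_hexads_iff (by decide)).2 (by decide +kernel)
  exact (Finset.card_le_card hle).trans_lt
    (lt_of_lt_of_le (by decide +kernel) (Finset.card_le_card hge))

/-- The representatives of the powers of `2` modulo `17`. -/
def twoPow (k : Fin 8) : ℕ := 2 ^ k.val % 17

lemma isSquare_iff_twoPow : (∀ m : ZMod 17, m * m ≠ 0 → ∃ k, (m * m).val = twoPow k) ∧
    ∀ k, ∃ m : ZMod 17, m * m ≠ 0 ∧ (m * m).val = twoPow k := by
  decide +kernel

lemma twoPow_injective : Function.Injective twoPow := by decide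

lemma qr4Mem_iff_twoPow {K : Type} [Field K] [Algebra F4 K] (α : K) (c : Fin 17 → F4) :
    qr4Mem α c ↔ ∀ k, ∑ i : Fin 17, algebraMap F4 K (c i) * (α ^ twoPow k) ^ (i : ℕ) = 0 := by
  simp only [qr4Mem, ← pow_mul]
  constructor
  · intro h k
    obtain ⟨m, hm, hk⟩ := isSquare_iff_twoPow.2 k
    rw [← hk]
    exact h _ hm ⟨m, rfl⟩
  · rintro h _ hm ⟨m, rfl⟩
    obtain ⟨k, hk⟩ := isSquare_iff_twoPow.1 m hm
    rw [hk]
    exact h k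

/-- The entries of `H` in column `i < 17` and row `r < 8` are the coefficients of the remainder of
`X ^ i` modulo the polynomial `X ^ 8 - ∑ r, H r 8 * X ^ r`. -/
structure IsRemainderMatrix (H : Fin 9 → Fin 18 → ZMod 2) : Prop where
  unit : ∀ r : Fin 8, H r.castSucc 0 = if r = 0 then 1 else 0
  step_zero : ∀ i : Fin 16, H 0 i.succ.castSucc = H 7 i.castSucc.castSucc * H 0 8
  step_succ : ∀ (i : Fin 16) (r : Fin 7), H r.succ.castSucc i.succ.castSucc =
    H r.castSucc.castSucc i.castSucc.castSucc + H 7 i.castSucc.castSucc * H r.succ.castSucc 8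
  last : ∀ r : Fin 8, H r.castSucc 17 = 0
  parity : ∀ i, H 8 i = 1

lemma isRemainderMatrix_residue : IsRemainderMatrix (bitMatrix residueColumns) := by
  constructor <;> decide +kernel

lemma isRemainderMatrix_nonresidue : IsRemainderMatrix (bitMatrix nonresidueColumns) := by
  constructor <;> decide +kernel

variable {K : Type} [Field K] [Algebra F4 K]

/-- The embedding of the prime field into `K`. -/
abbrev ofZModTwo (K : Type) [Field K] [Algebra F4 K] : ZMod 2 →+* K :=
  (algebraMap F4 K).comp (algebraMap (ZMod 2) F4)

lemma pow_eq_remainder {H : Fin 9 → Fin 18 → ZMod 2} (hH : IsRemainderMatrix H) {β : K}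
    (hβ : β ^ 8 = ∑ r : Fin 8, ofZModTwo K (H r.castSucc 8) * β ^ (r : ℕ)) (i : Fin 17) :
    β ^ (i : ℕ) = ∑ r : Fin 8, ofZModTwo K (H r.castSucc i.castSucc) * β ^ (r : ℕ) := by
  induction i using Fin.induction with
  | zero => simp [hH.unit]
  | succ i ih =>
    have hstep (r : Fin 7) := congrArg (ofZModTwo K) (hH.step_succ i r)
    have hzero := congrArg (ofZModTwo K) (hH.step_zero i)
    rw [Fin.val_succ, pow_succ, ← Fin.val_castSucc, ih]
    generalize ofZModTwo K = φ at hβ hstep hzero ⊢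
    simp only [map_add, map_mul] at hstep hzero
    rw [Fin.sum_univ_castSucc, Fin.sum_univ_succ (n := 7)
      (f := fun r => φ (H r.castSucc i.succ.castSucc) * β ^ (r : ℕ))]
    rw [Fin.sum_univ_succ, Fin.castSucc_zero] at hβ
    simp only [Fin.val_succ] at hβ
    simp only [hstep, add_mul, Finset.sum_add_distrib, mul_assoc, ← Finset.mul_sum, Finset.sum_mul,
      Fin.val_succ, Fin.val_castSucc, ← pow_succ]
    rw [show (Fin.last 7).castSucc = (7 : Fin 9) from rfl, Fin.castSucc_zero, Fin.val_last, hzero]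
    linear_combination φ (H 7 i.castSucc.castSucc) * hβ

lemma sum_mul_pow_sq (a : Fin 8 → ZMod 2) (β : K) :
    (∑ r : Fin 8, ofZModTwo K (a r) * β ^ (r : ℕ)) ^ 2 =
      ∑ r : Fin 8, ofZModTwo K (a r) * (β ^ 2) ^ (r : ℕ) := by
  have : CharP K 2 := charP_of_injective_algebraMap (algebraMap F4 K).injective 2
  rw [sum_pow_char]
  refine Finset.sum_congr rfl fun r _ => ?_
  rw [mul_pow, ← map_pow, ZMod.pow_card, pow_right_comm]

lemma root_pow_two_pow {a : Fin 8 → ZMod 2} {β : K}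
    (hβ : β ^ 8 = ∑ r : Fin 8, ofZModTwo K (a r) * β ^ (r : ℕ)) (k : ℕ) :
    (β ^ 2 ^ k) ^ 8 = ∑ r : Fin 8, ofZModTwo K (a r) * (β ^ 2 ^ k) ^ (r : ℕ) := by
  induction k with
  | zero => simpa using hβ
  | succ k ih => rw [pow_succ 2, pow_mul, ← sum_mul_pow_sq, ← ih, pow_right_comm]

lemma qr4Mem_iff_remainder {H : Fin 9 → Fin 18 → ZMod 2} (hH : IsRemainderMatrix H) {α : K}
    (hα : IsPrimitiveRoot α 17)
    (hroot : α ^ 8 = ∑ r : Fin 8, ofZModTwo K (H r.castSucc 8) * α ^ (r : ℕ))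
    (c : Fin 17 → F4) :
    qr4Mem α c ↔
      ∀ r : Fin 8, ∑ i, algebraMap (ZMod 2) F4 (H r.castSucc i.castSucc) * c i = 0 := by
  have hpow (k : Fin 8) : α ^ twoPow k = α ^ 2 ^ k.val := by
    have h := pow_mod_orderOf α (2 ^ k.val)
    rwa [← hα.eq_orderOf] at h
  have hsum (k : Fin 8) : ∑ i : Fin 17, algebraMap F4 K (c i) * (α ^ twoPow k) ^ (i : ℕ) =
      ∑ r : Fin 8, (α ^ twoPow k) ^ (r : ℕ) *
        algebraMap F4 K (∑ i, algebraMap (ZMod 2) F4 (H r.castSucc i.castSucc) * c i) := by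
    simp only [map_sum, map_mul, Finset.mul_sum]
    rw [Finset.sum_comm]
    refine Finset.sum_congr rfl fun i _ => ?_
    rw [pow_eq_remainder hH (hpow k ▸ root_pow_two_pow hroot k) i, Finset.mul_sum]
    exact Finset.sum_congr rfl fun r _ => by simp only [RingHom.comp_apply]; ring
  simp only [qr4Mem_iff_twoPow, hsum]
  constructor
  · intro h r
    have hinj : Function.Injective fun k => α ^ twoPow k := fun k l hkl =>
      twoPow_injective (hα.pow_inj (Nat.mod_lt _ (by decide)) (Nat.mod_lt _ (by decide)) hkl)
    exact (map_eq_zero_iff _ (algebraMap F4 K).injective).1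
      (congrFun (Matrix.eq_zero_of_forall_index_sum_pow_mul_eq_zero hinj h) r)
  · intro h k
    simp [h]

lemma extQR4Mem_iff_inKernel {H : Fin 9 → Fin 18 → ZMod 2} (hH : IsRemainderMatrix H) {α : K}
    (hα : IsPrimitiveRoot α 17)
    (hroot : α ^ 8 = ∑ r : Fin 8, ofZModTwo K (H r.castSucc 8) * α ^ (r : ℕ))
    (c : Fin 18 → F4) : extQR4Mem α c ↔ InKernel H c := by
  rw [extQR4Mem, qr4Mem_iff_remainder hH hα hroot, InKernel,
    Fin.forall_fin_succ' (P := fun r => ∑ i, algebraMap (ZMod 2) F4 (H r i) * c i = 0)]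
  have h17 (r : Fin 8) : H r.castSucc (Fin.last 17) = 0 := hH.last r
  have h8 (i : Fin 18) : H (Fin.last 8) i = 1 := hH.parity i
  refine and_congr (forall_congr' fun r => ?_) ?_
  · rw [Fin.sum_univ_castSucc (n := 17), h17, map_zero, zero_mul, add_zero]
  · simp only [h8, map_one, one_mul]
    rw [Fin.sum_univ_castSucc (n := 17), eq_neg_iff_add_eq_zero, add_comm]

lemma root_residue_or_nonresidue {α : K} (hα : IsPrimitiveRoot α 17) :
    (α ^ 8 = ∑ r : Fin 8, ofZModTwo K (bitMatrix residueColumns r.castSucc 8) * α ^ (r : ℕ)) ∨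
    α ^ 8 = ∑ r : Fin 8, ofZModTwo K (bitMatrix nonresidueColumns r.castSucc 8) * α ^ (r : ℕ) := by
  have : CharP K 2 := charP_of_injective_algebraMap (algebraMap F4 K).injective 2
  have h2 : (2 : K) = 0 := CharTwo.two_eq_zero
  have hsum : (α ^ 8 + α ^ 5 + α ^ 4 + α ^ 3 + 1) *
      (α ^ 8 + α ^ 7 + α ^ 6 + α ^ 4 + α ^ 2 + α + 1) = 0 := by
    have h := hα.geom_sum_eq_zero (by decide)
    simp only [Finset.sum_range_succ, Finset.sum_range_zero] at h
    linear_combination h + (1 * α ^ 4 + 1 * α ^ 5 + 1 * α ^ 6 + 1 * α ^ 7 +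
      1 * α ^ 8 + 1 * α ^ 9 + 1 * α ^ 10 + 1 * α ^ 11 + 1 * α ^ 12) * h2
  have hr : (fun r : Fin 8 => bitMatrix residueColumns r.castSucc 8) =
      ![1, 0, 0, 1, 1, 1, 0, 0] := by decide +kernel
  have hn : (fun r : Fin 8 => bitMatrix nonresidueColumns r.castSucc 8) =
      ![1, 1, 1, 0, 1, 0, 1, 1] := by decide +kernel
  simp only [fun r => congrFun hr r, fun r => congrFun hn r, Fin.sum_univ_eight]
  refine (mul_eq_zero.1 hsum).imp (fun h => ?_) (fun h => ?_)
  · simp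
    linear_combination h - (α ^ 5 + α ^ 4 + α ^ 3 + 1) * h2
  · simp
    linear_combination h - (α ^ 7 + α ^ 6 + α ^ 4 + α ^ 2 + α + 1) * h2

end QuadraticResidueCode

/-- The automorphism group of the extended quaternary quadratic residue code `C` of length
18 (all coordinate permutations sending codewords to codewords) acts on the 3-element
subsets of `{1, …, 18}` with exactly 2 orbits. -/
theorem quaternary_aut_orbits_on_triples (K : Type) [Field K] [Algebra F4 K] (α : K)
    (hα : IsPrimitiveRoot α 17) :
    {O : Set (Finset (Fin 18)) | ∃ T : Finset (Fin 18), T.card = 3 ∧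
      O = {T' | ∃ σ : Equiv.Perm (Fin 18),
        (∀ c : Fin 18 → F4, extQR4Mem α c → extQR4Mem α (c ∘ σ)) ∧
        T.image σ = T'}}.ncard = 2 := by
  rcases root_residue_or_nonresidue hα with hroot | hroot
  · rw [show (extQR4Mem α : (Fin 18 → F4) → Prop) = InKernel (bitMatrix residueColumns) from
      funext fun c => propext (extQR4Mem_iff_inKernel isRemainderMatrix_residue hα hroot c)]
    exact ncard_orbits_eq_two translation_mem_preserving_residue doubling_mem_preserving_residue
      inversion_mem_preserving_residue card_hexads_residue.ne'
  · rw [show (extQR4Mem α : (Fin 18 → F4) → Prop) = InKernel (bitMatrix nonresidueColumns) from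
      funext fun c => propext (extQR4Mem_iff_inKernel isRemainderMatrix_nonresidue hα hroot c)]
    exact ncard_orbits_eq_two translation_mem_preserving_nonresidue doubling_mem_preserving_nonresidue
      inversion_mem_preserving_nonresidue card_hexads_nonresidue.ne
end
end

section
/- Let C be the extended ternary quadratic residue code of length 14 and let f ∈ Harm_3 (a harmonic function of degree 3 on subsets of {1,…,14}) be fixed by the action of every element of Aut(C). Then there exists a real number c_f such that the harmonic weight enumerator w_{C,f}(x,y) = Σ_{c ∈ C} f̃(supp(c)) x^{14−wt(c)} y^{wt(c)} equals c_f · (−312 x^8 y^6 + 468 x^7 y^7 + 312 x^6 y^8 − 624 x^5 y^9 + 156 x^3 y^{11}) as a polynomial in ℝ[x,y]. -/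
open scoped Classical

noncomputable section

/-- The nonzero squares (`true`) and the nonsquares (`false`) modulo 13. -/
def residueClass : Bool → Finset (ZMod 13)
  | true => {1, 3, 4, 9, 10, 12}
  | false => {2, 5, 6, 7, 8, 11}

lemma mem_residueClass_true (ℓ : ZMod 13) : ℓ ∈ residueClass true ↔ ℓ ≠ 0 ∧ IsSquare ℓ := by
  have h : ∀ ℓ : ZMod 13, ℓ ∈ residueClass true ↔ ℓ ≠ 0 ∧ ∃ r, ℓ = r * r := by decide
  exact h ℓ

lemma image_mul_residueClass (ε : Bool) :
    ∀ k ∈ residueClass ε, (residueClass true).image (· * k) = residueClass ε := by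
  revert ε; decide

lemma sum_pow_eq_zero {K : Type} [Field K] {α : K} (hα : IsPrimitiveRoot α 13) :
    1 + α + α ^ 2 + α ^ 3 + α ^ 4 + α ^ 5 + α ^ 6 + α ^ 7 + α ^ 8 + α ^ 9 + α ^ 10 + α ^ 11
      + α ^ 12 = 0 := by
  have h := hα.geom_sum_eq_zero (by norm_num)
  simpa [Finset.sum_range_succ] using h

lemma sum_char_residueClass_true {K : Type} [Field K] {α : K} (h : α ^ 13 = 1) :
    ∑ s ∈ residueClass true, AddChar.zmodChar 13 h s =
      α + α ^ 3 + α ^ 4 + α ^ 9 + α ^ 10 + α ^ 12 := by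
  have : ∑ s ∈ residueClass true, AddChar.zmodChar 13 h s =
      α ^ 1 + (α ^ 3 + (α ^ 4 + (α ^ 9 + (α ^ 10 + (α ^ 12 + 0))))) := rfl
  rw [this]; ring

lemma sum_char_residueClass_false {K : Type} [Field K] {α : K} (h : α ^ 13 = 1) :
    ∑ s ∈ residueClass false, AddChar.zmodChar 13 h s =
      α ^ 2 + α ^ 5 + α ^ 6 + α ^ 7 + α ^ 8 + α ^ 11 := by
  have : ∑ s ∈ residueClass false, AddChar.zmodChar 13 h s =
      α ^ 2 + (α ^ 5 + (α ^ 6 + (α ^ 7 + (α ^ 8 + (α ^ 11 + 0))))) := rfl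
  rw [this]; ring

section Field

variable {K : Type} [Field K] [Algebra (ZMod 3) K] {α : K}

lemma three_eq_zero_of_algebra_s14 : (3 : K) = 0 := by
  have h : algebraMap (ZMod 3) K 3 = algebraMap (ZMod 3) K 0 := congrArg _ (by decide)
  rwa [map_zero, map_ofNat] at h

/-- In characteristic 3 the two Gaussian periods of order 6 modulo 13 are `-1` and `0`. -/
lemma exists_sum_char_residueClass (hα : IsPrimitiveRoot α 13) :
    ∃ ε, ∑ s ∈ residueClass ε, AddChar.zmodChar 13 hα.pow_eq_one s = -1 ∧
      ∑ s ∈ residueClass (!ε), AddChar.zmodChar 13 hα.pow_eq_one s = 0 := by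
  have h3 : (3 : K) = 0 := three_eq_zero_of_algebra_s14
  have hsum := sum_pow_eq_zero hα
  have h13 := hα.pow_eq_one
  have hprod : (α + α ^ 3 + α ^ 4 + α ^ 9 + α ^ 10 + α ^ 12) *
      (α ^ 2 + α ^ 5 + α ^ 6 + α ^ 7 + α ^ 8 + α ^ 11) = 0 := by
    linear_combination (3 * α + 3 * α ^ 2 + 2 * α ^ 3 + 3 * α ^ 4 + 2 * α ^ 5 + α ^ 6
      + 2 * α ^ 7 + α ^ 8 + α ^ 10) * h13 + (α + α ^ 2 + α ^ 3 + α ^ 4 + α ^ 5 + α ^ 6 + α ^ 7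
      + α ^ 8 + α ^ 9 + α ^ 10 + α ^ 11 + α ^ 12) * h3
  rcases mul_eq_zero.mp hprod with h | h
  · refine ⟨false, ?_, ?_⟩
    · rw [sum_char_residueClass_false]; linear_combination hsum - h
    · rw [Bool.not_false, sum_char_residueClass_true, h]
  · refine ⟨true, ?_, ?_⟩
    · rw [sum_char_residueClass_true]; linear_combination hsum - h
    · rw [Bool.not_true, sum_char_residueClass_false, h]

lemma sum_char_mul (hα : IsPrimitiveRoot α 13) {ε : Bool}
    (h₁ : ∑ s ∈ residueClass ε, AddChar.zmodChar 13 hα.pow_eq_one s = -1)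
    (h₀ : ∑ s ∈ residueClass (!ε), AddChar.zmodChar 13 hα.pow_eq_one s = 0) (k : ZMod 13) :
    ∑ ℓ ∈ residueClass true, AddChar.zmodChar 13 hα.pow_eq_one (ℓ * k) =
      if k ∈ residueClass ε then -1 else 0 := by
  have key : ∀ δ, k ∈ residueClass δ →
      ∑ ℓ ∈ residueClass true, AddChar.zmodChar 13 hα.pow_eq_one (ℓ * k) =
        ∑ s ∈ residueClass δ, AddChar.zmodChar 13 hα.pow_eq_one s := by
    intro δ hk
    have hk0 : k ≠ 0 := by rintro rfl; revert hk; revert δ; decide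
    have : Fact (Nat.Prime 13) := ⟨by norm_num⟩
    rw [← image_mul_residueClass δ k hk, Finset.sum_image (mul_left_injective₀ hk0).injOn]
  have cover : ∀ (ε : Bool) (k : ZMod 13),
      k = 0 ∨ k ∈ residueClass ε ∨ k ∈ residueClass (!ε) := by decide
  have disj : ∀ (ε : Bool) (k : ZMod 13),
      k = 0 ∨ k ∈ residueClass (!ε) → k ∉ residueClass ε := by decide
  rcases cover ε k with h | h | h
  · have hcard : (residueClass true).card = 6 := by decide
    rw [if_neg (disj ε k (Or.inl h)), h]
    simp only [mul_zero, AddChar.map_zero_eq_one, Finset.sum_const, hcard, nsmul_eq_mul, mul_one]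
    have h3 : (3 : K) = 0 := three_eq_zero_of_algebra_s14
    push_cast
    linear_combination 2 * h3
  · rw [if_pos h, key ε h, h₁]
  · rw [if_neg (disj ε k (Or.inr h)), key _ h, h₀]

lemma sum_char_mulShift (hα : IsPrimitiveRoot α 13) (k : ZMod 13) :
    ∑ j : ZMod 13, AddChar.zmodChar 13 hα.pow_eq_one (k * j) = if k = 0 then 1 else 0 := by
  have hprim := AddChar.zmodChar_primitive_of_primitive_root 13 hα
  have h := AddChar.sum_mulShift k hprim
  simp only [mul_comm k]
  rw [h]
  split_ifs with hk
  · have h3 : (3 : K) = 0 := three_eq_zero_of_algebra_s14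
    rw [ZMod.card]; push_cast; linear_combination 4 * h3
  · simp

/-- A parity-check description of the quadratic residue code: a word belongs to the code iff its
cyclic correlations with the indicator of one of the two residue classes vanish. -/
lemma exists_qr3Mem_iff (hα : IsPrimitiveRoot α 13) :
    ∃ ε, ∀ c : ZMod 13 → ZMod 3, qr3Mem α c ↔
      ∀ j : ZMod 13, ∑ i : ZMod 13, (if i - j ∈ residueClass ε then c i else 0) = 0 := by
  obtain ⟨ε, h₁, h₀⟩ := exists_sum_char_residueClass hα
  refine ⟨ε, fun c => ?_⟩
  set ψ := AddChar.zmodChar 13 hα.pow_eq_one with hψ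
  set a : ZMod 13 → K := fun i => algebraMap (ZMod 3) K (c i)
  have hmem : qr3Mem α c ↔ ∀ ℓ ∈ residueClass true, ∑ i : ZMod 13, a i * ψ (ℓ * i) = 0 := by
    have hpow (ℓ i : ZMod 13) : ψ (ℓ * i) = α ^ (ℓ.val * i.val) := by
      rw [hψ, AddChar.zmodChar_apply, ZMod.val_mul]
      exact (pow_eq_pow_mod _ hα.pow_eq_one).symm
    simp only [hpow, mem_residueClass_true, and_imp]
    rfl
  have hcorr (j : ZMod 13) :
      ∑ ℓ ∈ residueClass true, ψ (-(ℓ * j)) * ∑ i : ZMod 13, a i * ψ (ℓ * i) =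
        -algebraMap (ZMod 3) K (∑ i : ZMod 13, (if i - j ∈ residueClass ε then c i else 0)) := by
    have (i : ZMod 13) := sum_char_mul hα h₁ h₀ (i - j)
    simp only [Finset.mul_sum]
    rw [Finset.sum_comm, map_sum, ← Finset.sum_neg_distrib]
    refine Finset.sum_congr rfl fun i _ => ?_
    calc _ = a i * ∑ ℓ ∈ residueClass true, ψ (ℓ * (i - j)) := by
          rw [Finset.mul_sum]
          refine Finset.sum_congr rfl fun ℓ _ => ?_
          rw [mul_sub, sub_eq_neg_add, AddChar.map_add_eq_mul]; ring
      _ = _ := by rw [this]; split_ifs <;> simp [a]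
  rw [hmem]
  constructor
  · intro h j
    have := hcorr j
    rw [Finset.sum_eq_zero fun ℓ hℓ => by rw [h ℓ hℓ, mul_zero], eq_comm, neg_eq_zero] at this
    exact (map_eq_zero _).mp this
  · intro h m hm
    have hinv : ∑ j : ZMod 13, ψ (m * j) *
        ∑ ℓ ∈ residueClass true, ψ (-(ℓ * j)) * ∑ i : ZMod 13, a i * ψ (ℓ * i) = 0 :=
      Finset.sum_eq_zero fun j _ => by rw [hcorr, h j, map_zero, neg_zero, mul_zero]
    rw [← hinv]
    simp only [Finset.mul_sum (residueClass true)]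
    rw [Finset.sum_comm]
    have hshift (ℓ : ZMod 13) : ∑ j : ZMod 13, ψ (m * j) *
        (ψ (-(ℓ * j)) * ∑ i : ZMod 13, a i * ψ (ℓ * i)) =
        if m - ℓ = 0 then ∑ i : ZMod 13, a i * ψ (ℓ * i) else 0 := by
      simp only [← mul_assoc, ← Finset.sum_mul, ← AddChar.map_add_eq_mul]
      have (j : ZMod 13) : m * j + -(ℓ * j) = (m - ℓ) * j := by ring
      simp only [this]
      rw [sum_char_mulShift hα]; split_ifs <;> simp
    simp only [hshift, sub_eq_zero]
    rw [Finset.sum_ite_eq, if_pos hm]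

end Field

/-- The ternary vector stored as a pair (mask of the support, mask of the entries `2`). Bits of the
second mask outside the support are irrelevant. -/
def decode (p : ℕ × ℕ) (i : Fin 14) : ZMod 3 :=
  if p.1.testBit i then if p.2.testBit i then 2 else 1 else 0

/-- Bitwise addition of ternary vectors. -/
def bitAdd (x y : ℕ × ℕ) : ℕ × ℕ :=
  ((x.1 ^^^ y.1) ||| (x.1 ^^^ (x.1 &&& (x.2 ^^^ y.2))),
    (x.1 &&& x.2) ^^^ (y.1 &&& y.2) ^^^ ((x.1 &&& y.1) ^^^ (x.1 &&& y.1 &&& x.2)))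

lemma decode_bitAdd (x y : ℕ × ℕ) : decode (bitAdd x y) = decode x + decode y := by
  ext1 i
  simp only [decode, bitAdd, Pi.add_apply, Nat.testBit_or, Nat.testBit_xor, Nat.testBit_and]
  generalize x.1.testBit i = a, x.2.testBit i = b, y.1.testBit i = c, y.2.testBit i = d
  revert a b c d
  decide

/-- The sum of `2 ^ (s * i)` over the positions `i < n` of the nonzero bits of `m`. -/
def spread (s m : ℕ) : ℕ → ℕ
  | 0 => 0
  | n + 1 => spread s m n + m / 2 ^ n % 2 * 2 ^ (s * n)

lemma spread_eq (s : ℕ) (p : ℕ × ℕ) :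
    spread s p.1 14 = ∑ i : Fin 14, if decode p i ≠ 0 then 2 ^ (s * (i : ℕ)) else 0 := by
  have h (n : ℕ) : spread s p.1 n =
      ∑ i ∈ Finset.range n, if p.1.testBit i then 2 ^ (s * i) else 0 := by
    induction n with
    | zero => rfl
    | succ n ih =>
      rw [spread, ih, Finset.sum_range_succ, ← Nat.toNat_testBit]
      cases p.1.testBit n <;> simp
  rw [h, Finset.sum_range]
  refine Finset.sum_congr rfl fun i _ => ?_
  have : decode p i ≠ 0 ↔ p.1.testBit i := by
    unfold decode
    generalize p.1.testBit i = a, p.2.testBit i = b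
    revert a b
    decide
  simp only [this]

/-- A single number recording all ordered triples in a support, tagged by its weight. -/
def leaf (m : ℕ) : ℕ :=
  2 ^ (12 * spread 0 m 14) *
    (spread 180 m 14 * spread (180 * 14) m 14 * spread (180 * 14 * 14) m 14)

/-- The sum of `leaf` over the affine span of `v` by the given vectors. -/
def tally : List (ℕ × ℕ) → ℕ × ℕ → ℕ
  | [], v => leaf v.1
  | g :: gs, v => tally gs v + tally gs (bitAdd v g) + tally gs (bitAdd (bitAdd v g) g)

/-- The position of an ordered triple in the number computed by `leaf`. -/
def tripleIndex (q : (Fin 14 × Fin 14) × Fin 14) : Fin (14 * 14 * 14) :=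
  finProdFinEquiv (finProdFinEquiv q.1, q.2)

/-- The weight-enumerating number of the words whose support contains `i`, `j` and `k`. -/
def coverSum {ι : Type} [Fintype ι] (w : ι → Fin 14 → ZMod 3) (q : (Fin 14 × Fin 14) × Fin 14) :
    ℕ :=
  ∑ m, if w m q.1.1 ≠ 0 ∧ w m q.1.2 ≠ 0 ∧ w m q.2 ≠ 0 then 4096 ^ wt (w m) else 0

/-- The contribution of a word to the number recording all triples. -/
def tripleSum (c : Fin 14 → ZMod 3) : ℕ :=
  ∑ q : (Fin 14 × Fin 14) × Fin 14,
    (if c q.1.1 ≠ 0 ∧ c q.1.2 ≠ 0 ∧ c q.2 ≠ 0 then 4096 ^ wt c else 0) *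
      (4096 ^ 15) ^ (tripleIndex q : ℕ)

lemma leaf_eq (p : ℕ × ℕ) : leaf p.1 = tripleSum (decode p) := by
  have hwt : spread 0 p.1 14 = wt (decode p) := by
    rw [spread_eq, wt, Finset.card_filter]
    simp only [zero_mul, pow_zero]
    congr!
  rw [leaf, hwt, tripleSum]
  simp only [spread_eq, Fintype.sum_prod_type, Finset.mul_sum, Finset.sum_mul]
  refine Finset.sum_congr rfl fun i _ => Finset.sum_congr rfl fun j _ =>
    Finset.sum_congr rfl fun k _ => ?_
  have hidx : (tripleIndex ((i, j), k) : ℕ) = k + 14 * (j + 14 * i) := rfl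
  have h2 : (4096 : ℕ) = 2 ^ 12 := rfl
  rw [hidx, h2, ← pow_mul, ← pow_mul, ← pow_mul]
  by_cases hi : decode p i = 0
  · simp [hi]
  by_cases hj : decode p j = 0
  · simp [hj]
  by_cases hk : decode p k = 0
  · simp [hk]
  rw [if_pos hi, if_pos hj, if_pos hk, if_pos ⟨hi, hj, hk⟩]
  simp only [← pow_add]
  congr 1
  ring

lemma tally_eq {n : ℕ} (g : Fin n → ℕ × ℕ) (v : ℕ × ℕ) (F : (Fin 14 → ZMod 3) → ℕ)
    (hF : ∀ p, leaf p.1 = F (decode p)) :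
    tally (List.ofFn g) v =
      ∑ m : Fin n → ZMod 3, F (decode v + ∑ t, m t • decode (g t)) := by
  induction n generalizing v with
  | zero => simp [tally, hF]
  | succ n ih =>
    have hsum3 (G : ZMod 3 → ℕ) : ∑ a, G a = G 0 + G 1 + G 2 := Fin.sum_univ_three G
    have h2 (x : Fin 14 → ZMod 3) : (2 : ZMod 3) • x = x + x := two_smul _ x
    rw [List.ofFn_succ, tally, ih, ih, ih,
      ← (Fin.consEquiv fun _ : Fin (n + 1) => ZMod 3).sum_comp, Fintype.sum_prod_type, hsum3]
    simp [Fin.sum_univ_succ, decode_bitAdd, h2, Fin.consEquiv, add_assoc]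

lemma sum_pow_div_mod {n B : ℕ} (F : Fin n → ℕ) (hF : ∀ e, F e < B) (k : Fin n) :
    (∑ e, F e * B ^ (e : ℕ)) / B ^ (k : ℕ) % B = F k := by
  induction n with
  | zero => exact k.elim0
  | succ n ih =>
    have hB : 0 < B := (Nat.zero_le _).trans_lt (hF 0)
    have hsplit : ∑ e, F e * B ^ (e : ℕ) = F 0 + B * ∑ e : Fin n, F e.succ * B ^ (e : ℕ) := by
      rw [Fin.sum_univ_succ, Finset.mul_sum]
      simp [pow_succ, mul_comm, mul_left_comm]
    rw [hsplit]
    cases k using Fin.cases with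
    | zero => simp [Nat.mod_eq_of_lt (hF 0)]
    | succ k =>
      rw [Fin.val_succ, pow_succ', ← Nat.div_div_eq_div_mul, Nat.add_mul_div_left _ _ hB,
        Nat.div_eq_of_lt (hF 0), zero_add]
      exact ih (fun e => F e.succ) (fun e => hF _) k

/-- The words spanned by seven vectors. -/
def spanWord (g : Fin 7 → ℕ × ℕ) (m : Fin 7 → ZMod 3) : Fin 14 → ZMod 3 :=
  ∑ t, m t • decode (g t)

lemma wt_le {n : ℕ} {F : Type} [Zero F] (c : Fin n → F) : wt c ≤ n :=
  (Finset.card_le_univ _).trans_eq (Fintype.card_fin n)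

lemma card_coefficients : Fintype.card (Fin 7 → ZMod 3) = 2187 := by
  simp [ZMod.card]

lemma tally_div_mod (g : Fin 7 → ℕ × ℕ) (q : (Fin 14 × Fin 14) × Fin 14) :
    tally (List.ofFn g) (0, 0) / (4096 ^ 15) ^ (tripleIndex q : ℕ) % 4096 ^ 15 =
      coverSum (spanWord g) q := by
  have hinj : Function.Bijective tripleIndex :=
    finProdFinEquiv.bijective.comp (finProdFinEquiv.prodCongr (Equiv.refl _)).bijective
  let e := Equiv.ofBijective _ hinj
  have h0 : decode (0, 0) = 0 := by ext1 i; simp [decode]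
  have htot : tally (List.ofFn g) (0, 0) =
      ∑ n, coverSum (spanWord g) (e.symm n) * (4096 ^ 15) ^ (n : ℕ) := by
    rw [tally_eq g _ _ leaf_eq, ← e.sum_comp]
    simp only [h0, zero_add, e.symm_apply_apply, tripleSum]
    rw [Finset.sum_comm]
    exact Finset.sum_congr rfl fun q _ => (Finset.sum_mul ..).symm
  have hlt (q) : coverSum (spanWord g) q < 4096 ^ 15 := by
    calc coverSum (spanWord g) q ≤ ∑ _m : Fin 7 → ZMod 3, 4096 ^ 14 := by
          refine Finset.sum_le_sum fun m _ => ?_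
          split_ifs
          · exact Nat.pow_le_pow_right (by norm_num) (wt_le _)
          · exact Nat.zero_le _
      _ < 4096 ^ 15 := by
          rw [Finset.sum_const, Finset.card_univ, card_coefficients]; norm_num
  rw [htot]
  have := sum_pow_div_mod (fun n => coverSum (spanWord g) (e.symm n)) (fun n => hlt _) (e q)
  rwa [e.symm_apply_apply] at this

/-- The number of words of weight `w` whose support contains `z`. -/
def coverCount {ι : Type} [Fintype ι] (v : ι → Fin 14 → ZMod 3) (z : Finset (Fin 14)) (w : ℕ) :
    ℕ :=
  (Finset.univ.filter fun m => z ⊆ supp (v m) ∧ wt (v m) = w).card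

lemma coverCount_eq (g : Fin 7 → ℕ × ℕ) (q : (Fin 14 × Fin 14) × Fin 14) (w : Fin 15) :
    coverCount (spanWord g) {q.1.1, q.1.2, q.2} w =
      coverSum (spanWord g) q / 4096 ^ (w : ℕ) % 4096 := by
  have hsum : coverSum (spanWord g) q =
      ∑ w : Fin 15, coverCount (spanWord g) {q.1.1, q.1.2, q.2} w * 4096 ^ (w : ℕ) := by
    simp only [coverCount, Finset.card_filter, Finset.sum_mul]
    rw [Finset.sum_comm, coverSum]
    refine Finset.sum_congr rfl fun m _ => ?_
    have hsub : {q.1.1, q.1.2, q.2} ⊆ supp (spanWord g m) ↔ spanWord g m q.1.1 ≠ 0 ∧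
        spanWord g m q.1.2 ≠ 0 ∧ spanWord g m q.2 ≠ 0 := by
      simp [supp, Finset.insert_subset_iff]
    rw [Finset.sum_eq_single (⟨wt (spanWord g m), Nat.lt_succ_of_le (wt_le _)⟩ : Fin 15)]
    · simp [hsub]
    · intro b _ hb
      have : wt (spanWord g m) ≠ b := fun h => hb (Fin.ext h.symm)
      simp [this]
    · simp
  rw [hsum, sum_pow_div_mod]
  intro w
  calc _ ≤ 2187 := (Finset.card_le_univ _).trans_eq card_coefficients
    _ < 4096 := by norm_num

/-- Systematic generator matrices of the codes checked by the two residue classes; bit `i` of a mask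
is coordinate `i`. -/
def generator : Bool → Fin 7 → ℕ × ℕ
  | true => ![(15233, 2560), (7810, 1664),
      (10116, 9344), (12040, 10496),
      (15888, 12800), (6048, 5632),
      (15808, 1280)]
  | false => ![(11905, 3584), (15618, 7168),
      (15492, 13312), (8072, 1536),
      (13200, 8832), (11168, 896),
      (14144, 1792)]

/-- Matrices recovering the last six coordinates of the cyclic code from its parity checks. -/
def checkInverse : Bool → Matrix (Fin 6) (Fin 6) (ZMod 3)
  | true => !![2, 1, 2, 2, 2, 1;
      1, 2, 1, 1, 2, 2;
      2, 1, 2, 2, 1, 2;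
      1, 0, 0, 2, 1, 2;
      2, 1, 0, 1, 2, 1;
      1, 2, 1, 2, 1, 2]
  | false => !![1, 1, 1, 0, 1, 1;
      2, 1, 2, 2, 1, 1;
      1, 1, 1, 0, 2, 0;
      2, 0, 0, 1, 2, 1;
      1, 1, 0, 1, 1, 1;
      2, 1, 2, 1, 2, 1]

/-- The matrix of cyclic parity checks attached to a residue class. -/
def checkEntry (ε : Bool) (i j : ZMod 13) : ZMod 3 := if i - j ∈ residueClass ε then 1 else 0

/-- The parity checks of the extended quadratic residue code attached to a residue class. -/
def IsCodeword (ε : Bool) (c : Fin 14 → ZMod 3) : Prop :=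
  (∀ j : Fin 13, ∑ i : Fin 13, checkEntry ε i j * c i.castSucc = 0) ∧
  c (Fin.last 13) = -∑ i : Fin 13, c i.castSucc

lemma isCodeword_generator (ε : Bool) (t : Fin 7) : IsCodeword ε (decode (generator ε t)) := by
  constructor
  · revert ε t; decide +kernel
  · revert ε t; decide +kernel

lemma generator_castLE (ε : Bool) (s t : Fin 7) :
    decode (generator ε s) (Fin.castLE (by norm_num) t) = if t = s then 1 else 0 := by
  revert ε s t; decide +kernel

lemma spanWord_castLE (ε : Bool) (m : Fin 7 → ZMod 3) (t : Fin 7) :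
    spanWord (generator ε) m (Fin.castLE (by norm_num) t) = m t := by
  simp [spanWord, generator_castLE]

lemma spanWord_injective (ε : Bool) : Function.Injective (spanWord (generator ε)) := fun m n h =>
  funext fun t => by rw [← spanWord_castLE ε m t, h, spanWord_castLE]

lemma checkInverse_mul (ε : Bool) (x : Fin 6) (i : Fin 13) :
    ∑ j : Fin 6, checkInverse ε x j *
      checkEntry ε i (Fin.castLE (n := 6) (m := 13) (by norm_num) j) =
    (if i = Fin.natAdd 7 x then 1 else 0) -
      if h : (i : ℕ) < 7 then decode (generator ε ⟨i, h⟩) (Fin.natAdd 7 x).castSucc else 0 := by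
  revert ε x i; decide +kernel

lemma isCodeword_spanWord (ε : Bool) (m : Fin 7 → ZMod 3) :
    IsCodeword ε (spanWord (generator ε) m) := by
  constructor
  · intro j
    simp only [spanWord, Finset.sum_apply, Pi.smul_apply, smul_eq_mul, Finset.mul_sum,
      mul_left_comm _ (m _)]
    rw [Finset.sum_comm]
    simp only [← Finset.mul_sum, (isCodeword_generator ε _).1, mul_zero, Finset.sum_const_zero]
  · simp only [spanWord, Finset.sum_apply, Pi.smul_apply, smul_eq_mul]
    rw [Finset.sum_comm]
    simp only [← Finset.mul_sum, (isCodeword_generator ε _).2, mul_neg, Finset.sum_neg_distrib]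

lemma isCodeword_iff (ε : Bool) (c : Fin 14 → ZMod 3) :
    IsCodeword ε c ↔ ∃ m, spanWord (generator ε) m = c := by
  refine ⟨fun hc => ⟨fun t => c (Fin.castLE (by norm_num) t), ?_⟩, ?_⟩
  swap
  · rintro ⟨m, rfl⟩; exact isCodeword_spanWord ε m
  set m : Fin 7 → ZMod 3 := fun t => c (Fin.castLE (by norm_num) t) with hm
  have hcyc (y : Fin 13) : spanWord (generator ε) m y.castSucc = c y.castSucc := by
    refine Fin.addCases (m := 7) (n := 6) (fun t => ?_) (fun x => ?_) y
    · exact spanWord_castLE ε m t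
    · have h : ∑ i : Fin 13, (∑ j : Fin 6, checkInverse ε x j *
          checkEntry ε i (Fin.castLE (n := 6) (m := 13) (by norm_num) j)) * c i.castSucc = 0 := by
        simp only [Finset.sum_mul]
        rw [Finset.sum_comm]
        refine Finset.sum_eq_zero fun j _ => ?_
        simp only [mul_assoc, ← Finset.mul_sum]
        rw [hc.1, mul_zero]
      simp only [checkInverse_mul, sub_mul, Finset.sum_sub_distrib, ite_mul, one_mul, zero_mul,
        Finset.sum_ite_eq', Finset.mem_univ, if_true] at h
      rw [sub_eq_zero] at h
      refine Eq.trans ?_ h.symm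
      refine Eq.trans ?_ (Fin.sum_univ_add (a := 7) (b := 6) _).symm
      simp [spanWord, hm, mul_comm]
      rfl
  ext1 y
  cases y using Fin.lastCases with
  | last => rw [(isCodeword_spanWord ε m).2, hc.2]; simp only [hcyc]
  | cast y => exact hcyc y

/-- The two possible distributions, over the weights, of the words covering a triple. -/
def coverTable : Bool → Fin 15 → ℕ
  | true => ![0, 0, 0, 0, 0, 0, 12, 12, 54, 88, 180, 164, 110, 0, 28]
  | false => ![0, 0, 0, 0, 0, 0, 8, 18, 58, 80, 180, 166, 110, 0, 28]

lemma coverTable_div_mod (b : Bool) (w : Fin 15) :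
    (∑ w : Fin 15, coverTable b w * 4096 ^ (w : ℕ)) / 4096 ^ (w : ℕ) % 4096 = coverTable b w :=
  sum_pow_div_mod _ (by revert b; decide) w

lemma tally_generator (ε : Bool) : ∀ i j k : Fin 14, i < j → j < k → ∃ b,
    tally (List.ofFn (generator ε)) (0, 0) / (4096 ^ 15) ^ (tripleIndex ((i, j), k) : ℕ) %
      4096 ^ 15 = ∑ w : Fin 15, coverTable b w * 4096 ^ (w : ℕ) := by
  revert ε; decide +kernel

lemma exists_coverCount (ε : Bool) {z : Finset (Fin 14)} (hz : z.card = 3) :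
    ∃ b, ∀ w : Fin 15, coverCount (spanWord (generator ε)) z w = coverTable b w := by
  let e := z.orderEmbOfFin hz
  obtain ⟨b, hb⟩ := tally_generator ε (e 0) (e 1) (e 2) (e.strictMono (by decide))
    (e.strictMono (by decide))
  have hz' : z = {e 0, e 1, e 2} := by
    have huniv : (Finset.univ : Finset (Fin 3)) = {0, 1, 2} := rfl
    rw [← Finset.image_orderEmbOfFin_univ z hz, huniv]
    simp only [Finset.image_insert, Finset.image_singleton, e]
  refine ⟨b, fun w => ?_⟩
  rw [tally_div_mod] at hb
  rw [hz', coverCount_eq _ ((e 0, e 1), e 2), hb, coverTable_div_mod]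

lemma exists_extQR3Mem_iff {K : Type} [Field K] [Algebra (ZMod 3) K] {α : K}
    (hα : IsPrimitiveRoot α 13) :
    ∃ ε, ∀ c : Fin 14 → ZMod 3, extQR3Mem α c ↔ IsCodeword ε c := by
  obtain ⟨ε, hε⟩ := exists_qr3Mem_iff hα
  refine ⟨ε, fun c => and_congr ((hε fun i => c i.castSucc).trans ?_) Iff.rfl⟩
  refine forall_congr' fun j => ?_
  simp only [checkEntry, ite_mul, one_mul, zero_mul]
  rfl

/-- The values of a harmonic function of degree 3 sum to zero. -/
lemma sum_eq_zero_of_harmonic (f : Finset (Fin 14) → ℝ)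
    (hharm : ∀ y : Finset (Fin 14), y.card = 2 →
      ∑ z ∈ Finset.univ.filter (fun z : Finset (Fin 14) => z.card = 3 ∧ y ⊆ z), f z = 0) :
    ∑ z ∈ Finset.univ.powersetCard 3, f z = 0 := by
  have h : ∑ y ∈ Finset.univ.powersetCard 2,
      ∑ z ∈ Finset.univ.filter (fun z : Finset (Fin 14) => z.card = 3 ∧ y ⊆ z), f z = 0 :=
    Finset.sum_eq_zero fun y hy => hharm y (Finset.mem_powersetCard.mp hy).2
  rw [Finset.sum_comm' (t' := Finset.univ.powersetCard 3) (s' := fun z => z.powersetCard 2)] at h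
  · have h3 : ∀ z ∈ (Finset.univ : Finset (Fin 14)).powersetCard 3,
        ∑ _y ∈ z.powersetCard 2, f z = 3 * f z := by
      intro z hz
      rw [Finset.sum_const, Finset.card_powersetCard, (Finset.mem_powersetCard.mp hz).2]
      simp [Nat.choose]
    rw [Finset.sum_congr rfl h3, ← Finset.mul_sum] at h
    simpa using h
  · intro y z
    simp only [Finset.mem_powersetCard, Finset.mem_filter, Finset.mem_univ, Finset.subset_univ,
      true_and]
    tauto

/-- The harmonic weight enumerator grouped by weight. -/
lemma sum_harmonic_monomial {ι : Type} [Fintype ι] (v : ι → Fin 14 → ZMod 3)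
    (f : Finset (Fin 14) → ℝ) :
    (∑ m, MvPolynomial.C (∑ z ∈ (supp (v m)).powersetCard 3, f z) *
        MvPolynomial.X 0 ^ (14 - wt (v m)) * MvPolynomial.X 1 ^ wt (v m) :
      MvPolynomial (Fin 2) ℝ) =
    ∑ w : Fin 15, MvPolynomial.C (∑ z ∈ Finset.univ.powersetCard 3, f z * coverCount v z w) *
      MvPolynomial.X 0 ^ (14 - (w : ℕ)) * MvPolynomial.X 1 ^ (w : ℕ) := by
  have hcoef (w : ℕ) : ∑ z ∈ Finset.univ.powersetCard 3, f z * coverCount v z w =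
      ∑ m, if wt (v m) = w then ∑ z ∈ (supp (v m)).powersetCard 3, f z else 0 := by
    simp only [coverCount, Finset.card_filter, Nat.cast_sum, Finset.mul_sum]
    rw [Finset.sum_comm]
    refine Finset.sum_congr rfl fun m _ => ?_
    have hsub : (supp (v m)).powersetCard 3 =
        (Finset.univ.powersetCard 3).filter fun z => z ⊆ supp (v m) := by
      ext z
      simp [Finset.mem_powersetCard, and_comm]
    rw [hsub, Finset.sum_filter]
    by_cases hw : wt (v m) = w <;> simp [hw]
  simp only [hcoef, map_sum, Finset.sum_mul]
  rw [Finset.sum_comm]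
  refine Finset.sum_congr rfl fun m _ => ?_
  rw [Finset.sum_eq_single (⟨wt (v m), Nat.lt_succ_of_le (wt_le _)⟩ : Fin 15)]
  · simp [Finset.sum_mul]
  · intro b _ hb
    have : wt (v m) ≠ b := fun h => hb (Fin.ext h.symm)
    simp [this]
  · simp

/-- The coefficients of the harmonic weight enumerator are proportional to the difference of the
two cover distributions. -/
lemma exists_sum_mul_coverCount (ε : Bool) (f : Finset (Fin 14) → ℝ)
    (hf : ∑ z ∈ Finset.univ.powersetCard 3, f z = 0) :
    ∃ a : ℝ, ∀ w : Fin 15,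
      ∑ z ∈ Finset.univ.powersetCard 3, f z * coverCount (spanWord (generator ε)) z w =
        a * ((coverTable true w : ℝ) - coverTable false w) := by
  have h : ∀ z : Finset (Fin 14), ∃ b, z.card = 3 →
      ∀ w : Fin 15, coverCount (spanWord (generator ε)) z w = coverTable b w := by
    intro z
    by_cases hz : z.card = 3
    · obtain ⟨b, hb⟩ := exists_coverCount ε hz
      exact ⟨b, fun _ => hb⟩
    · exact ⟨true, fun h => absurd h hz⟩
  choose b hb using h
  refine ⟨∑ z ∈ Finset.univ.powersetCard 3, if b z then f z else 0, fun w => ?_⟩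
  have hterm : ∀ z ∈ (Finset.univ : Finset (Fin 14)).powersetCard 3,
      f z * coverCount (spanWord (generator ε)) z w = f z * coverTable false w +
        (if b z then f z else 0) * ((coverTable true w : ℝ) - coverTable false w) := by
    intro z hz
    rw [hb z (Finset.mem_powersetCard.mp hz).2]
    cases b z
    · simp
    · simp only [if_true]; ring
  rw [Finset.sum_congr rfl hterm, Finset.sum_add_distrib, ← Finset.sum_mul, ← Finset.sum_mul, hf,
    zero_mul, zero_add]

open MvPolynomial in
/-- Harmonic weight enumerator of the extended ternary quadratic residue code `C` of length
14: for every degree-3 harmonic function `f` (on 3-element subsets of the coordinates,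
extended by `f̃(u) = ∑_{z ⊆ u, |z| = 3} f z`) that is fixed by the action of every
automorphism of `C`, there is a constant `c_f` with
`w_{C,f}(x,y) = ∑_{c ∈ C} f̃(supp c) x^(14 - wt c) y^(wt c)
  = c_f (−312 x⁸y⁶ + 468 x⁷y⁷ + 312 x⁶y⁸ − 624 x⁵y⁹ + 156 x³y¹¹)`. -/
theorem ternary_harmonic_weight_enumerator (K : Type) [Field K] [Algebra (ZMod 3) K] (α : K)
    (hα : IsPrimitiveRoot α 13) (f : Finset (Fin 14) → ℝ)
    (hharm : ∀ y : Finset (Fin 14), y.card = 2 →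
      ∑ z ∈ Finset.univ.filter (fun z : Finset (Fin 14) => z.card = 3 ∧ y ⊆ z), f z = 0)
    (hinv : ∀ σ : Equiv.Perm (Fin 14),
      (∀ c : Fin 14 → ZMod 3, extQR3Mem α c → extQR3Mem α (c ∘ σ)) →
      ∀ z : Finset (Fin 14), z.card = 3 → f (z.image ⇑σ⁻¹) = f z) :
    ∃ cf : ℝ,
      (∑ c ∈ Finset.univ.filter (fun c : Fin 14 → ZMod 3 => extQR3Mem α c),
          C (∑ z ∈ (supp c).powersetCard 3, f z) * X 0 ^ (14 - wt c) * X 1 ^ wt c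
        : MvPolynomial (Fin 2) ℝ) =
      C cf * (C (-312 : ℝ) * X 0 ^ 8 * X 1 ^ 6 + C (468 : ℝ) * X 0 ^ 7 * X 1 ^ 7
        + C (312 : ℝ) * X 0 ^ 6 * X 1 ^ 8 + C (-624 : ℝ) * X 0 ^ 5 * X 1 ^ 9
        + C (156 : ℝ) * X 0 ^ 3 * X 1 ^ 11) := by
  obtain ⟨ε, hε⟩ := exists_extQR3Mem_iff hα
  obtain ⟨a, ha⟩ := exists_sum_mul_coverCount ε f (sum_eq_zero_of_harmonic f hharm)
  obtain ⟨d, rfl⟩ : ∃ d, a = -78 * d := ⟨-a / 78, by ring⟩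
  refine ⟨d, ?_⟩
  have himage : Finset.univ.filter (fun c : Fin 14 → ZMod 3 => extQR3Mem α c) =
      Finset.univ.image (spanWord (generator ε)) := by
    ext c
    simp [hε, isCodeword_iff]
  rw [himage, Finset.sum_image (spanWord_injective ε).injOn, sum_harmonic_monomial]
  simp only [ha, map_mul, map_sub, map_natCast, map_neg, map_ofNat]
  simp only [Fin.sum_univ_succ, Fin.sum_univ_zero, coverTable, Matrix.cons_val_zero,
    Matrix.cons_val_succ, Fin.val_succ, Fin.val_zero]
  push_cast
  ring
end
end
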